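/- arXiv:1903.04214 — 4 statements merged into one kernel-verified Lean document; each statement's English description precedes it below -/
import Mathlib

section
/- Let Σ be a finite alphabet, let W be a finite nonempty set of nonempty finite partial words over Σ, and let p be an integer with p ≥ 2·max{|w| : w ∈ W}. Suppose there exist a language L of finite words over Σ and a function f : ℕ_{>0} → ℕ_{>0} such that: (I) the empty word belongs to L; (II) for every u ∈ L and every w ∈ W there are at least f(|w|) different words v ∈ Σ^{|w|} compatible with w such that uv ∈ L; (III) every u ∈ L avoids squares of period less than p; and (IV) defining, for u, v ∈ W, α(|u|,|v|) = Σ_{m=1}^{|u|} Σ_{j=0}^{⌊(|v|−1)/m⌋} min{f(|v|), (|Σ|−1)^{|v|−1−jm}} and, for integers 1 ≤ i ≤ |v|, α'(i,|v|) = Σ_{m=0}^{i−1} min{f(|v|), (|Σ|−1)^m}, there exist real numbers x_i ∈ (0,1) for each i ∈ {|u| : u ∈ W} and a function β : {0,…,p} → [0,1] satisfying: for every j ≤ p, β(j) = max{ ∏_{i ∈ {|u| : u ∈ W}} x_i^{n_i} : n_i ∈ ℕ for each i and Σ_i i·n_i = j } (with the conventions that an empty product equals 1 and the maximum over an empty set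 equals 0), and for every w ∈ W, f(|w|) − max_{u,v ∈ W, 1 ≤ r ≤ |v|} { β(r + p − |w| − |v|) · ( α'(r,|w|) + x_{|v|}·α(|u|,|w|)/(1 − x_{|u|}) ) } ≥ x_{|w|}^{−1}. Then for every infinite partial word μ that is a concatenation of infinitely many elements of W, the set S(μ) of finite square-free words over Σ compatible with μ is infinite. -/
/-- A finite word is square-free: no factor is of the form `v ++ v` with `v` nonempty. -/
def SqFree {α : Type*} (u : List α) : Prop :=
  ∀ v : List α, v ≠ [] → ¬ ((v ++ v) <:+: u)

/-- `u` avoids squares of period less than `p`. -/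
def AvoidsSquaresLt {α : Type*} (p : ℕ) (u : List α) : Prop :=
  ∀ v : List α, v ≠ [] → v.length < p → ¬ ((v ++ v) <:+: u)

/-- `v` is compatible with the finite partial word `μ` (where `none` is the wildcard `⋄`). -/
def CompatFin {α : Type*} (v : List α) (μ : List (Option α)) : Prop :=
  v.length ≤ μ.length ∧
    ∀ i : ℕ, i < v.length → ∀ a : α, μ[i]? = some (some a) → v[i]? = some a

/-- `v` is compatible with the infinite partial word `μ` (where `none` is the wildcard `⋄`). -/
def CompatInf {α : Type*} (v : List α) (μ : ℕ → Option α) : Prop :=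
  ∀ i : ℕ, i < v.length → ∀ a : α, μ i = some a → v[i]? = some a

/-- `μ` is an infinite concatenation of elements of `W`. -/
def InOmega {α : Type*} (W : Set (List α)) (μ : ℕ → α) : Prop :=
  ∃ g : ℕ → List α, (∀ k, g k ∈ W) ∧
    ∀ k i : ℕ, i < (g k).length →
      (g k)[i]? = some (μ ((∑ j ∈ Finset.range k, (g j).length) + i))

/-- The quantity `α(a, b)` of the main theorem, where `q = |Σ|`. -/
def alphaA (q : ℕ) (f : ℕ → ℕ) (a b : ℕ) : ℕ :=
  ∑ m ∈ Finset.Icc 1 a, ∑ j ∈ Finset.range ((b - 1) / m + 1),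
    min (f b) ((q - 1) ^ (b - 1 - j * m))

/-- The quantity `α'(i, b)` of the main theorem, where `q = |Σ|`. -/
def alphaA' (q : ℕ) (f : ℕ → ℕ) (i b : ℕ) : ℕ :=
  ∑ m ∈ Finset.range i, min (f b) ((q - 1) ^ m)

theorem sq_of_per {α : Type*} (s : List α) (a t : ℕ) (ht : 0 < t) (hl : a + 2 * t ≤ s.length)
    (h : ∀ i < t, s[a+i]? = s[a+t+i]?) :
    ∃ v : List α, v ≠ [] ∧ v.length = t ∧ (v ++ v) <:+: s := by
  have hlen : ((s.drop a).take t).length = t := by simp; omega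
  refine ⟨(s.drop a).take t, ?_, hlen, ?_⟩
  · intro h0
    rw [h0] at hlen
    simp at hlen; omega
  · have : (s.drop a).take t ++ (s.drop a).take t = (s.drop a).take (2*t) := by
      apply List.ext_getElem?
      intro i
      rw [List.getElem?_append, hlen]
      simp only [List.getElem?_take, List.getElem?_drop]
      split_ifs with h1 h2 h3 h4
      · rfl
      · omega
      · rw [h (i - t) (by omega)]
        congr 1; omega
      · omega
      · omega
      · rfl
    rw [this]
    exact (List.take_prefix _ _).isInfix.trans (List.drop_suffix _ _).isInfix

theorem per_of_sq {α : Type*} (s v : List α) (h : (v ++ v) <:+: s) :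
    ∃ a, a + 2 * v.length ≤ s.length ∧ ∀ i < v.length, s[a+i]? = s[a+v.length+i]? := by
  obtain ⟨l, r, rfl⟩ := h
  refine ⟨l.length, by simp; omega, ?_⟩
  intro i hi
  have e1 : (l ++ (v ++ v) ++ r)[l.length + i]? = v[i]? := by
    rw [List.append_assoc, List.getElem?_append_right (by omega)]
    rw [List.append_assoc, List.getElem?_append_left (by omega)]
    congr 1; omega
  have e2 : (l ++ (v ++ v) ++ r)[l.length + v.length + i]? = v[i]? := by
    rw [List.append_assoc, List.getElem?_append_right (by omega)]
    rw [List.append_assoc, List.getElem?_append_right (by omega),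
      List.getElem?_append_left (by omega)]
    congr 1; omega
  rw [e1, e2]

theorem SqFree.take' {α : Type*} {s : List α} (h : SqFree s) (n : ℕ) : SqFree (s.take n) :=
  fun v hv hi => h v hv (hi.trans (List.take_prefix _ _).isInfix)

/-- number of words without consecutive equal letters and with given nonempty prefix -/
theorem count_ext {α : Type*} [Fintype α] [DecidableEq α] (m : ℕ) (hm : 0 < m) (e : ℕ) :
    ∀ F : Finset (List α), (∀ s ∈ F, s.length = m + e) →
    (∀ s ∈ F, ∀ s' ∈ F, s.take m = s'.take m) →
    (∀ s ∈ F, ∀ i, i + 1 < s.length → s[i]? ≠ s[i+1]?) →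
    F.card ≤ (Fintype.card α - 1) ^ e := by
  induction e with
  | zero =>
    intro F h1 h2 _
    rw [pow_zero, Finset.card_le_one]
    intro s hs s' hs'
    have := h2 s hs s' hs'
    rwa [List.take_of_length_le (by rw [h1 s hs]; omega),
      List.take_of_length_le (by rw [h1 s' hs']; omega)] at this
  | succ e ih =>
    intro F h1 h2 h3
    have hI := ih (F.image (fun s => s.take (m+e))) (by
      intro s hs
      obtain ⟨s', hs', rfl⟩ := Finset.mem_image.1 hs
      simp [h1 s' hs']) (by
      intro s hs z hz
      obtain ⟨s', hs', rfl⟩ := Finset.mem_image.1 hs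
      obtain ⟨z', hz', rfl⟩ := Finset.mem_image.1 hz
      simp only [List.take_take]
      rw [min_eq_left (by omega)]
      exact h2 _ hs' _ hz') (by
      intro s hs i hi
      obtain ⟨s', hs', rfl⟩ := Finset.mem_image.1 hs
      simp [h1 s' hs'] at hi
      simp only [List.getElem?_take]
      rw [if_pos (by omega), if_pos (by omega)]
      exact h3 s' hs' i (by rw [h1 s' hs']; omega))
    have := Finset.card_le_mul_card_image (f := fun s => s.take (m+e)) F (Fintype.card α - 1) (by
      intro c hc
      obtain ⟨s0, hs0, rfl⟩ := Finset.mem_image.1 hc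
      have hl0 := h1 s0 hs0
      have hb : m + e - 1 < s0.length := by omega
      rw [← Finset.card_univ, ← Finset.card_erase_of_mem (Finset.mem_univ (s0[m+e-1]'hb))]
      have key : ∀ s ∈ F.filter (fun s => s.take (m+e) = s0.take (m+e)), s[m+e]? ≠ s0[m+e-1]? := by
        intro s hs
        rw [Finset.mem_filter] at hs
        have h4 := h3 s hs.1 (m+e-1) (by rw [h1 s hs.1]; omega)
        have h5 : (s.take (m+e))[m+e-1]? = (s0.take (m+e))[m+e-1]? := by rw [hs.2]
        simp only [List.getElem?_take] at h5
        rw [if_pos (by omega), if_pos (by omega)] at h5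
        rw [← h5]
        intro h6
        apply h4
        rw [← h6]; congr 1; omega
      refine Finset.card_le_card_of_injOn (fun s => (s[m+e]?).getD (s0[m+e-1]'hb)) ?_ ?_
      · intro s hs
        have hs' := Finset.mem_coe.1 hs
        have hk := key s hs'
        have hl := h1 s (Finset.mem_filter.1 hs').1
        rw [List.getElem?_eq_getElem hb, List.getElem?_eq_getElem (by omega)] at hk
        simp only [Finset.coe_erase, Finset.coe_univ]
        refine ⟨Set.mem_univ _, ?_⟩
        rw [List.getElem?_eq_getElem (by omega)]
        simpa using hk
      · intro s hs s' hs' hss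
        have hs := Finset.mem_filter.1 (Finset.mem_coe.1 hs)
        have hs' := Finset.mem_filter.1 (Finset.mem_coe.1 hs')
        have hl := h1 s hs.1
        have hl' := h1 s' hs'.1
        simp only at hss
        rw [List.getElem?_eq_getElem (by omega), List.getElem?_eq_getElem (by omega)] at hss
        simp only [Option.getD_some] at hss
        apply List.ext_getElem?
        intro i
        rcases lt_trichotomy i (m+e) with h | h | h
        · have : (s.take (m+e))[i]? = (s'.take (m+e))[i]? := by rw [hs.2, hs'.2]
          simpa only [List.getElem?_take, if_pos h] using this
        · subst h
          rw [List.getElem?_eq_getElem (by omega), List.getElem?_eq_getElem (by omega), hss]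
        · rw [List.getElem?_eq_none (by omega), List.getElem?_eq_none (by omega)])
    calc F.card ≤ _ := this
      _ ≤ (Fintype.card α - 1) * (Fintype.card α - 1)^e := Nat.mul_le_mul_left _ hI
      _ = _ := by ring

theorem spaced_sum (V : Finset ℕ) (b m : ℕ) (hm : 0 < m) (h : ℕ → ℕ) (hh : Monotone h)
    (hV : ∀ e ∈ V, e < b) (hsp : ∀ e ∈ V, ∀ e' ∈ V, e < e' → m ≤ e' - e) :
    ∑ e ∈ V, h e ≤ ∑ j ∈ Finset.range ((b - 1) / m + 1), h (b - 1 - j * m) := by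
  have hinj : Set.InjOn (fun e => (b - 1 - e) / m) (V : Set ℕ) := by
    have aux : ∀ e ∈ V, ∀ e' ∈ V, e < e' → (b - 1 - e) / m ≠ (b - 1 - e') / m := by
      intro e he e' he' hlt heq
      have h1 := hsp e he e' he' hlt
      have h2 := hV e' he'
      have h3 : b - 1 - e = (b - 1 - e') + (e' - e) := by omega
      have h4 : (b - 1 - e') / m + 1 ≤ (b - 1 - e) / m := by
        rw [← Nat.add_div_right _ hm]
        exact Nat.div_le_div_right (by omega)
      omega
    intro e he e' he' heq
    rcases lt_trichotomy e e' with h1 | h1 | h1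
    · exact absurd heq (aux e he e' he' h1)
    · exact h1
    · exact absurd heq.symm (aux e' he' e he h1)
  calc ∑ e ∈ V, h e ≤ ∑ e ∈ V, h (b - 1 - ((b - 1 - e) / m) * m) := by
        apply Finset.sum_le_sum
        intro e he
        apply hh
        have := hV e he
        have := Nat.div_mul_le_self (b - 1 - e) m
        omega
    _ = ∑ j ∈ V.image (fun e => (b - 1 - e) / m), h (b - 1 - j * m) := by
        rw [Finset.sum_image hinj]
    _ ≤ _ := by
        apply Finset.sum_le_sum_of_subset
        intro j hj
        obtain ⟨e, he, rfl⟩ := Finset.mem_image.1 hj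
        rw [Finset.mem_range]
        have : (b - 1 - e) / m ≤ (b - 1) / m := Nat.div_le_div_right (by omega)
        omega

/-- periodicity: the block of length `t` ending at `n` is repeated after `n` -/
def Per {α : Type*} (s : List α) (n t : ℕ) : Prop :=
  t ≤ n ∧ ∀ i, n ≤ i → i < n + t → s[i]? = s[i - t]?

theorem take_ext' {α : Type*} {s s' : List α} {n : ℕ} (h : ∀ i < n, s[i]? = s'[i]?) :
    s.take n = s'.take n := by
  apply List.ext_getElem?
  intro i
  simp only [List.getElem?_take]
  split_ifs with h1
  · exact h i h1
  · rfl

theorem take_ext_iff' {α : Type*} {s s' : List α} {n : ℕ} (h : s.take n = s'.take n) :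
    ∀ i < n, s[i]? = s'[i]? := by
  intro i hi
  have : (s.take n)[i]? = (s'.take n)[i]? := by rw [h]
  simpa only [List.getElem?_take, if_pos hi] using this

theorem agree {α : Type*} {s s' : List α} {n t : ℕ} (h : ∀ i < n, s[i]? = s'[i]?)
    (h1 : Per s n t) (h2 : Per s' n t) : s.take (n + t) = s'.take (n + t) := by
  apply take_ext'
  intro i hi
  by_cases hin : i < n
  · exact h i hin
  · rw [h1.2 i (by omega) hi, h2.2 i (by omega) hi]
    have := h1.1
    exact h _ (by omega)

theorem prod_le_beta {α : Type*} (W : Finset (List (Option α))) (p : ℕ) (x β : ℕ → ℝ)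
    (hx : ∀ w ∈ W, 0 < x w.length ∧ x w.length < 1)
    (hβ : ∀ j : ℕ, j ≤ p → β j = sSup {r : ℝ | ∃ m : ℕ → ℕ,
      (∀ i : ℕ, i ∉ W.image List.length → m i = 0) ∧
      (∑ i ∈ W.image List.length, i * m i) = j ∧
      r = ∏ i ∈ W.image List.length, x i ^ m i})
    (g : ℕ → List (Option α)) (hg : ∀ k, g k ∈ W) (I : Finset ℕ)
    (hI : ∑ i ∈ I, (g i).length ≤ p) :
    ∏ i ∈ I, x (g i).length ≤ β (∑ i ∈ I, (g i).length) := by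
  rw [hβ _ hI]
  apply le_csSup
  · refine ⟨1, ?_⟩
    rintro r ⟨m, -, -, rfl⟩
    apply Finset.prod_le_one
    · intro i hi
      obtain ⟨w, hw, rfl⟩ := Finset.mem_image.1 hi
      exact pow_nonneg (hx w hw).1.le _
    · intro i hi
      obtain ⟨w, hw, rfl⟩ := Finset.mem_image.1 hi
      exact pow_le_one₀ (hx w hw).1.le (hx w hw).2.le
  · have hmaps : ∀ i ∈ I, (g i).length ∈ W.image List.length :=
      fun i _ => Finset.mem_image_of_mem _ (hg i)
    refine ⟨fun l => (I.filter (fun i => (g i).length = l)).card, ?_, ?_, ?_⟩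
    · intro l hl
      rw [Finset.card_eq_zero, Finset.filter_eq_empty_iff]
      intro i _ h
      exact hl (h ▸ Finset.mem_image_of_mem _ (hg i))
    · rw [← Finset.sum_fiberwise_of_maps_to hmaps]
      apply Finset.sum_congr rfl
      intro l _
      rw [Finset.sum_congr rfl (g := fun _ => l) (fun i hi => (Finset.mem_filter.1 hi).2)]
      simp [mul_comm]
    · rw [← Finset.prod_fiberwise_of_maps_to hmaps]
      apply Finset.prod_congr rfl
      intro l _
      rw [Finset.prod_congr rfl (g := fun _ => x l)
        (fun i hi => by rw [(Finset.mem_filter.1 hi).2])]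
      simp

/-- Properties of the set of candidate extensions. -/
structure Cand {α : Type*} [DecidableEq α] (X : Finset (List α)) (N b fb : ℕ) : Prop where
  bpos : 0 < b
  ble : b ≤ N
  len : ∀ s ∈ X, s.length = N
  cons : ∀ s ∈ X, ∀ i, i + 1 < s.length → s[i]? ≠ s[i+1]?
  fib : ∀ u, (X.filter (fun s => s.take (N - b) = u)).card ≤ fb

theorem Cand.count {α : Type*} [Fintype α] [DecidableEq α] {X : Finset (List α)} {N b fb : ℕ}
    (hX : Cand X N b fb) (F : Finset (List α)) (hF : F ⊆ X) (e : ℕ) (he : e < b)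
    (h : ∀ s ∈ F, ∀ s' ∈ F, s.take (N - e) = s'.take (N - e)) :
    F.card ≤ min fb ((Fintype.card α - 1) ^ e) := by
  have := hX.ble
  apply le_min
  · rcases F.eq_empty_or_nonempty with rfl | ⟨s0, hs0⟩
    · simp
    · refine le_trans (Finset.card_le_card ?_) (hX.fib (s0.take (N - b)))
      intro s hs
      rw [Finset.mem_filter]
      refine ⟨hF hs, ?_⟩
      apply take_ext'
      intro i hi
      exact take_ext_iff' (h s hs s0 hs0) i (by omega)
  · refine count_ext (N - e) (by omega) e F ?_ h ?_
    · intro s hs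
      rw [hX.len s (hF hs)]; omega
    · intro s hs
      exact hX.cons s (hF hs)

theorem Cand.low {α : Type*} [Fintype α] [DecidableEq α] {X : Finset (List α)} {N b : ℕ}
    {f : ℕ → ℕ} (hX : Cand X N b (f b)) (hq : 0 < Fintype.card α - 1)
    (M a : ℕ) (y : List α) (hc : SqFree y) (hcl : y.length = M)
    (B : Finset (List α)) (hB : B ⊆ X) (hBc : ∀ s ∈ B, s.take M = y)
    (h : ∀ s ∈ B, ∃ d e n t, d < a ∧ e < b ∧ n + d = M ∧ n + t + e = N ∧ a ≤ t ∧ Per s n t) :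
    B.card ≤ alphaA (Fintype.card α) f a b := by
  classical
  let F : ℕ → ℕ → Finset (List α) := fun d e =>
    B.filter (fun s => ∃ n t, n + d = M ∧ n + t + e = N ∧ a ≤ t ∧ Per s n t)
  let V : ℕ → Finset ℕ := fun d => (Finset.range b).filter (fun e => (F d e).Nonempty)
  have hcov : B ⊆ (Finset.range a).biUnion (fun d => (V d).biUnion (fun e => F d e)) := by
    intro s hs
    obtain ⟨d, e, n, t, hd, he, h1, h2, h3, h4⟩ := h s hs
    have hsF : s ∈ F d e := Finset.mem_filter.2 ⟨hs, n, t, h1, h2, h3, h4⟩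
    rw [Finset.mem_biUnion]
    refine ⟨d, Finset.mem_range.2 hd, ?_⟩
    rw [Finset.mem_biUnion]
    exact ⟨e, Finset.mem_filter.2 ⟨Finset.mem_range.2 he, s, hsF⟩, hsF⟩
  have hmono : Monotone (fun e => min (f b) ((Fintype.card α - 1) ^ e)) := by
    intro e e' hee
    exact min_le_min le_rfl (Nat.pow_le_pow_right hq hee)
  have hcs : ∀ s ∈ B, ∀ i < M, s[i]? = y[i]? := by
    intro s hs i hi
    rw [← hBc s hs, List.getElem?_take, if_pos hi]
  have hFc : ∀ d < a, ∀ e < b, (F d e).card ≤ min (f b) ((Fintype.card α - 1) ^ e) := by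
    intro d hd e he
    refine hX.count (F d e) ((Finset.filter_subset _ _).trans hB) e he ?_
    intro s hs s' hs'
    obtain ⟨hsB, n, t, h1, h2, h3, h4⟩ := Finset.mem_filter.1 hs
    obtain ⟨hsB', n', t', h1', h2', h3', h4'⟩ := Finset.mem_filter.1 hs'
    obtain rfl : n = n' := by omega
    obtain rfl : t = t' := by omega
    have : N - e = n + t := by omega
    rw [this]
    refine agree ?_ h4 h4'
    intro i hi
    rw [hcs s hsB i (by omega), hcs s' hsB' i (by omega)]
  calc B.card ≤ _ := Finset.card_le_card hcov
    _ ≤ ∑ d ∈ Finset.range a, ((V d).biUnion (fun e => F d e)).card := Finset.card_biUnion_le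
    _ ≤ ∑ d ∈ Finset.range a, ∑ j ∈ Finset.range ((b - 1) / (d+1) + 1),
          min (f b) ((Fintype.card α - 1) ^ (b - 1 - j * (d+1))) := by
        apply Finset.sum_le_sum
        intro d hd
        have hd := Finset.mem_range.1 hd
        refine le_trans Finset.card_biUnion_le (le_trans (Finset.sum_le_sum
          (g := fun e => min (f b) ((Fintype.card α - 1) ^ e)) ?_)
          (spaced_sum (V d) b (d+1) (by omega) _ hmono ?_ ?_))
        · intro e he
          exact hFc d hd e (Finset.mem_range.1 (Finset.mem_filter.1 he).1)
        · intro e he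
          exact Finset.mem_range.1 (Finset.mem_filter.1 he).1
        · intro e he e' he' hlt
          obtain ⟨-, s, hs⟩ := Finset.mem_filter.1 he
          obtain ⟨-, s', hs'⟩ := Finset.mem_filter.1 he'
          obtain ⟨hsB, n, t, h1, h2, h3, h4, h5⟩ := Finset.mem_filter.1 hs
          obtain ⟨hsB', n', t', h1', h2', h3', h4', h5'⟩ := Finset.mem_filter.1 hs'
          obtain rfl : n = n' := by omega
          by_contra hcon
          obtain ⟨δ, rfl⟩ : ∃ δ, t = t' + δ := ⟨t - t', by omega⟩
          have hδ : δ = e' - e := by omega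
          obtain ⟨v, hv, -, hvc⟩ := sq_of_per y (n - (t' + δ)) δ (by omega) (by omega) (by
            intro i hi
            have e1 : y[n - (t' + δ) + i]? = y[n + i]? := by
              rw [← hcs s hsB _ (by omega), ← hcs s hsB _ (by omega), h5 (n+i) (by omega) (by omega)]
              congr 1; omega
            have e2 : y[n - (t' + δ) + δ + i]? = y[n + i]? := by
              rw [← hcs s' hsB' _ (by omega), ← hcs s' hsB' _ (by omega),
                h5' (n+i) (by omega) (by omega)]
              congr 1; omega
            rw [e1, e2])
          exact hc v hv hvc
    _ = alphaA (Fintype.card α) f a b := by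
        unfold alphaA
        rw [Finset.range_eq_Ico, Finset.sum_Ico_add' (fun m => ∑ j ∈ Finset.range ((b - 1) / m + 1),
          min (f b) ((Fintype.card α - 1) ^ (b - 1 - j * m))) 0 a 1]
        rfl

theorem Cand.top {α : Type*} [Fintype α] [DecidableEq α] {X : Finset (List α)} {N b : ℕ}
    {f : ℕ → ℕ} (hX : Cand X N b (f b)) (hq : 0 < Fintype.card α - 1)
    (M p Q r : ℕ) (hp : 0 < p) (hr : Q + p + r = N) (y : List α)
    (B : Finset (List α)) (hB : B ⊆ X) (hBc : ∀ s ∈ B, s.take M = y)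
    (h : ∀ s ∈ B, ∃ e n t, e < b ∧ Q < n ∧ n ≤ M ∧ n + t + e = N ∧ p ≤ t ∧ Per s n t) :
    B.card ≤ alphaA' (Fintype.card α) f r b := by
  classical
  let G : ℕ → Finset (List α) := fun τ =>
    B.filter (fun s => ∃ e n, e < b ∧ Q < n ∧ n ≤ M ∧ n + (p + τ) + e = N ∧ Per s n (p + τ))
  have hcov : B ⊆ (Finset.range r).biUnion G := by
    intro s hs
    obtain ⟨e, n, t, he, h1, h2, h3, h4, h5⟩ := h s hs
    obtain ⟨τ, rfl⟩ := Nat.exists_eq_add_of_le h4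
    rw [Finset.mem_biUnion]
    exact ⟨τ, Finset.mem_range.2 (by omega), Finset.mem_filter.2 ⟨hs, e, n, he, h1, h2, h3, h5⟩⟩
  have hcs : ∀ s ∈ B, ∀ i < M, s[i]? = y[i]? := by
    intro s hs i hi
    rw [← hBc s hs, List.getElem?_take, if_pos hi]
  have hG : ∀ τ < r, (G τ).card ≤ min (f b) ((Fintype.card α - 1) ^ (r - 1 - τ)) := by
    intro τ hτ
    rcases (G τ).eq_empty_or_nonempty with h0 | ⟨s0, hs0⟩
    · rw [h0]; simp
    have hex : ∃ n, ∃ s ∈ B, ∃ e, e < b ∧ Q < n ∧ n ≤ M ∧ n + (p + τ) + e = N ∧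
        Per s n (p + τ) := by
      obtain ⟨hsB, e, n, hh⟩ := Finset.mem_filter.1 hs0
      exact ⟨n, s0, hsB, e, hh⟩
    obtain ⟨z, hzB, e0, he0, hn1, hn2, hn3, hz⟩ := Nat.find_spec hex
    have hmin := fun m (hm : m < Nat.find hex) => Nat.find_min hex hm
    generalize Nat.find hex = n0 at *
    have hper : ∀ s ∈ G τ, Per s n0 (p + τ) := by
      intro s hs
      obtain ⟨hsB, e, n, g1, g2, g3, g4, g5⟩ := Finset.mem_filter.1 hs
      have hle : n0 ≤ n := by
        by_contra hlt
        exact hmin n (by omega) ⟨s, hsB, e, g1, g2, g3, g4, g5⟩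
      refine ⟨hz.1, ?_⟩
      intro i hi1 hi2
      by_cases hiM : i < M
      · rw [hcs s hsB i hiM, hcs s hsB (i - (p+τ)) (by omega), ← hcs z hzB i hiM,
          ← hcs z hzB (i - (p+τ)) (by omega)]
        exact hz.2 i hi1 hi2
      · exact g5.2 i (by omega) (by omega)
    refine le_trans (hX.count (G τ) ((Finset.filter_subset _ _).trans hB) e0 he0 ?_)
      (min_le_min le_rfl (Nat.pow_le_pow_right hq (by omega)))
    intro s hs s' hs'
    have : N - e0 = n0 + (p + τ) := by omega
    rw [this]
    refine agree ?_ (hper s hs) (hper s' hs')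
    intro i hi
    rw [hcs s (Finset.mem_filter.1 hs).1 i (by omega), hcs s' (Finset.mem_filter.1 hs').1 i (by omega)]
  calc B.card ≤ _ := Finset.card_le_card hcov
    _ ≤ ∑ τ ∈ Finset.range r, (G τ).card := Finset.card_biUnion_le
    _ ≤ ∑ τ ∈ Finset.range r, min (f b) ((Fintype.card α - 1) ^ (r - 1 - τ)) :=
        Finset.sum_le_sum (fun τ hτ => hG τ (Finset.mem_range.1 hτ))
    _ = _ := Finset.sum_range_reflect (fun m => min (f b) ((Fintype.card α - 1) ^ m)) r

theorem find_block (P : ℕ → ℕ) (hP0 : P 0 = 0) (n : ℕ) (hn : 0 < n) (K : ℕ) (hK : n ≤ P K) :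
    ∃ j < K, P j < n ∧ n ≤ P (j + 1) := by
  induction K with
  | zero => omega
  | succ K ih =>
    by_cases h : n ≤ P K
    · obtain ⟨j, hj, h1⟩ := ih h
      exact ⟨j, by omega, h1⟩
    · exact ⟨K, by omega, by omega, hK⟩

theorem step_bound {α : Type*} [Fintype α] [DecidableEq α] (S : ℕ → Finset (List α))
    (l P : ℕ → ℕ) (f : ℕ → ℕ) (p k : ℕ) (X : Finset (List α))
    (hq : 0 < Fintype.card α - 1)
    (hP0 : P 0 = 0) (hPs : ∀ k, P (k + 1) = P k + l k)
    (hlp : ∀ k, 2 * l k ≤ p) (hp : 2 ≤ p)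
    (hS : ∀ j, ∀ s ∈ S j, SqFree s ∧ s.length = P j)
    (hX : Cand X (P (k + 1)) (l k) (f (l k)))
    (hXS : ∀ s ∈ X, ∀ j ≤ k, s.take (P j) ∈ S j)
    (hXp : ∀ s ∈ X, AvoidsSquaresLt p s)
    (B : Finset (List α)) (hB : B ⊆ X) (hBs : ∀ s ∈ B, ¬ SqFree s) :
    B = ∅ ∨ ∃ J < k, ∃ r, 1 ≤ r ∧ r ≤ l J ∧ P J + p + r = P (k + 1) ∧
      B.card ≤ (S (J + 1)).card * alphaA' (Fintype.card α) f r (l k) +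
        ∑ j ∈ Finset.range J, (S (j + 1)).card * alphaA (Fintype.card α) f (l j) (l k) := by
  classical
  have hmonoP : Monotone P := monotone_nat_of_le_succ (fun n => by rw [hPs]; omega)
  -- every bad word has a long square
  have hbad : ∀ s ∈ B, ∃ e n t, e < l k ∧ n + t + e = P (k + 1) ∧ p ≤ t ∧ Per s n t := by
    intro s hs
    have h1 := hBs s hs
    unfold SqFree at h1
    push Not at h1
    obtain ⟨v, hv, hvs⟩ := h1
    have hvp : p ≤ v.length := by
      by_contra hlt
      exact hXp s (hB hs) v hv (by omega) hvs
    obtain ⟨a, ha, hper⟩ := per_of_sq s v hvs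
    have hlen := hX.len s (hB hs)
    have hgt : P k < a + 2 * v.length := by
      by_contra hle
      have hu := hS k _ (hXS s (hB hs) k le_rfl)
      obtain ⟨y, hy, -, hys⟩ := sq_of_per (s.take (P k)) a v.length (by omega)
        (by rw [hu.2]; omega) (by
          intro i hi
          simp only [List.getElem?_take]
          rw [if_pos (by omega), if_pos (by omega)]
          exact hper i hi)
      exact hu.1 y hy hys
    have := hPs k
    refine ⟨P (k+1) - (a + 2 * v.length), a + v.length, v.length, by omega, by omega, hvp,
      by omega, ?_⟩
    intro i h1 h2
    have := hper (i - a - v.length) (by omega)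
    have e1 : a + (i - a - v.length) = i - v.length := by omega
    have e2 : a + v.length + (i - a - v.length) = i := by omega
    rw [e1, e2] at this
    exact this.symm
  by_cases hN : P (k + 1) ≤ p
  · left
    rw [Finset.eq_empty_iff_forall_notMem]
    intro s hs
    obtain ⟨e, n, t, h1, h2, h3, h4, -⟩ := hbad s hs
    omega
  right
  have hk := hPs k
  have hlk := hlp k
  obtain ⟨J, hJk, hJ1, hJ2⟩ := find_block P hP0 (P (k+1) - p) (by omega) k (by omega)
  have hJs := hPs J
  refine ⟨J, hJk, P (k+1) - p - P J, by omega, by omega, by omega, ?_⟩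
  let C : ℕ → Finset (List α) := fun j => B.filter (fun s => ∃ e n t, e < l k ∧
    P j < n ∧ n ≤ P (j + 1) ∧ n + t + e = P (k + 1) ∧ p ≤ t ∧ Per s n t)
  have hcov : B ⊆ (Finset.range (J + 1)).biUnion C := by
    intro s hs
    obtain ⟨e, n, t, h1, h2, h3, h4⟩ := hbad s hs
    have := h4.1
    obtain ⟨j, hj, hj1, hj2⟩ := find_block P hP0 n (by omega) (J+1) (by omega)
    rw [Finset.mem_biUnion]
    exact ⟨j, Finset.mem_range.2 hj,
      Finset.mem_filter.2 ⟨hs, e, n, t, h1, hj1, hj2, h2, h3, h4⟩⟩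
  have hCB : ∀ j, C j ⊆ B := fun j => Finset.filter_subset _ _
  have htop : (C J).card ≤ (S (J + 1)).card *
      alphaA' (Fintype.card α) f (P (k+1) - p - P J) (l k) := by
    rw [mul_comm]
    refine Finset.card_le_mul_card_image_of_maps_to (f := fun s => s.take (P (J+1))) ?_ _ ?_
    · intro s hs
      exact hXS s (hB (hCB J hs)) (J+1) (by omega)
    · intro y hy
      refine hX.top hq (P (J+1)) p (P J) _ (by omega) (by omega) y _
        ((Finset.filter_subset _ _).trans ((hCB J).trans hB)) ?_ ?_
      · intro s hs
        exact (Finset.mem_filter.1 hs).2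
      · intro s hs
        exact (Finset.mem_filter.1 (Finset.mem_filter.1 hs).1).2
  have hlow : ∀ j < J, (C j).card ≤ (S (j + 1)).card * alphaA (Fintype.card α) f (l j) (l k) := by
    intro j hj
    rw [mul_comm]
    refine Finset.card_le_mul_card_image_of_maps_to (f := fun s => s.take (P (j+1))) ?_ _ ?_
    · intro s hs
      exact hXS s (hB (hCB j hs)) (j+1) (by omega)
    · intro y hy
      refine hX.low hq (P (j+1)) (l j) y (hS _ y hy).1 (hS _ y hy).2 _
        ((Finset.filter_subset _ _).trans ((hCB j).trans hB)) ?_ ?_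
      · intro s hs
        exact (Finset.mem_filter.1 hs).2
      · intro s hs
        obtain ⟨e, n, t, h1, h2, h3, h4, h5, h6⟩ :=
          (Finset.mem_filter.1 (Finset.mem_filter.1 hs).1).2
        have := hPs j
        have := hlp j
        exact ⟨P (j+1) - n, e, n, t, by omega, h1, by omega, h4, by omega, h6⟩
  calc B.card ≤ _ := Finset.card_le_card hcov
    _ ≤ ∑ j ∈ Finset.range (J+1), (C j).card := Finset.card_biUnion_le
    _ = (C J).card + ∑ j ∈ Finset.range J, (C j).card := by
        rw [Finset.sum_range_succ, add_comm]
    _ ≤ _ := Nat.add_le_add htop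
        (Finset.sum_le_sum (fun j hj => hlow j (Finset.mem_range.1 hj)))

theorem main_theorem
    {α : Type*} [Fintype α]
    (W : Finset (List (Option α))) (hWne : W.Nonempty) (hWwords : ∀ w ∈ W, w ≠ [])
    (p : ℕ) (hp : ∀ w ∈ W, 2 * w.length ≤ p)
    (L : Set (List α)) (f : ℕ → ℕ) (hf : ∀ n : ℕ, 0 < n → 0 < f n)
    (hI : [] ∈ L)
    (hII : ∀ u ∈ L, ∀ w ∈ W,
      f w.length ≤ Set.ncard {v : List α | v.length = w.length ∧ CompatFin v w ∧ u ++ v ∈ L})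
    (hIII : ∀ u ∈ L, AvoidsSquaresLt p u)
    (x : ℕ → ℝ) (β : ℕ → ℝ)
    (hx : ∀ w ∈ W, 0 < x w.length ∧ x w.length < 1)
    (hβrange : ∀ j : ℕ, j ≤ p → 0 ≤ β j ∧ β j ≤ 1)
    (hβ : ∀ j : ℕ, j ≤ p → β j = sSup {r : ℝ | ∃ m : ℕ → ℕ,
      (∀ i : ℕ, i ∉ W.image List.length → m i = 0) ∧
      (∑ i ∈ W.image List.length, i * m i) = j ∧
      r = ∏ i ∈ W.image List.length, x i ^ m i})
    (hmain : ∀ w ∈ W, ∀ u ∈ W, ∀ v ∈ W, ∀ r : ℕ, 1 ≤ r → r ≤ v.length →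
      (x w.length)⁻¹ ≤ (f w.length : ℝ) -
        β (r + p - w.length - v.length) *
          ((alphaA' (Fintype.card α) f r w.length : ℝ) +
            x v.length * (alphaA (Fintype.card α) f u.length w.length : ℝ)
              / (1 - x u.length))) :
    ∀ μ : ℕ → Option α, InOmega (↑W : Set (List (Option α))) μ →
      {v : List α | SqFree v ∧ CompatInf v μ}.Infinite := by
  classical
  rintro μ ⟨g, hg, hgμ⟩
  have hg : ∀ k, g k ∈ W := fun k => by simpa using hg k
  have hlpos : ∀ w ∈ W, 0 < w.length := fun w hw => List.length_pos_iff.2 (hWwords w hw)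
  have hp2 : 2 ≤ p := by
    obtain ⟨w, hw⟩ := hWne
    have := hlpos w hw
    have := hp w hw
    omega
  -- no two consecutive equal letters in L
  have hcons : ∀ s ∈ L, ∀ i, i + 1 < s.length → s[i]? ≠ s[i+1]? := by
    intro s hs i hi heq
    obtain ⟨v, hv, hvl, hvs⟩ := sq_of_per s i 1 (by omega) (by omega) (by
      intro j hj
      obtain rfl : j = 0 := by omega
      simpa using heq)
    exact hIII s hs v hv (by omega) hvs
  -- the chosen extensions
  have hE : ∀ u : List α, ∀ w : List (Option α), ∃ E : Finset (List α), u ∈ L → w ∈ W →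
      E.card = f w.length ∧ ∀ s ∈ E, s ∈ L ∧ ∃ v, s = u ++ v ∧ v.length = w.length ∧
        CompatFin v w := by
    intro u w
    by_cases hu : u ∈ L
    · by_cases hw : w ∈ W
      · have hfin : {v : List α | v.length = w.length ∧ CompatFin v w ∧ u ++ v ∈ L}.Finite :=
          (List.finite_length_eq α w.length).subset (fun v hv => hv.1)
        have h1 := hII u hu w hw
        rw [Set.ncard_eq_toFinset_card _ hfin] at h1
        obtain ⟨T, hT, hTc⟩ := Finset.exists_subset_card_eq h1
        refine ⟨T.image (fun v => u ++ v), fun _ _ => ⟨?_, ?_⟩⟩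
        · rw [Finset.card_image_of_injective _ (fun a b h => List.append_cancel_left h), hTc]
        · intro s hs
          obtain ⟨v, hv, rfl⟩ := Finset.mem_image.1 hs
          have := hT hv
          rw [Set.Finite.mem_toFinset] at this
          exact ⟨this.2.2, v, rfl, this.1, this.2.1⟩
      · exact ⟨∅, fun _ h => absurd h hw⟩
    · exact ⟨∅, fun h => absurd h hu⟩
  choose E hE using hE
  have hq : 0 < Fintype.card α - 1 := by
    obtain ⟨w, hw⟩ := hWne
    have hne : ∀ u ∈ L, ∃ v, u ++ v ∈ L ∧ v.length = w.length := by
      intro u hu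
      have h1 := hE u w hu hw
      have : 0 < (E u w).card := by rw [h1.1]; exact hf _ (hlpos w hw)
      obtain ⟨s, hs⟩ := Finset.card_pos.1 this
      obtain ⟨hsL, v, rfl, hv, -⟩ := h1.2 s hs
      exact ⟨v, hsL, hv⟩
    obtain ⟨v1, h1, h1'⟩ := hne [] hI
    obtain ⟨v2, h2, h2'⟩ := hne _ h1
    have hl := hlpos w hw
    have hlen : 1 < ([] ++ v1 ++ v2).length := by simp; omega
    have hc := hcons _ h2 0 hlen
    rw [List.getElem?_eq_getElem (by omega), List.getElem?_eq_getElem hlen] at hc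
    have : 1 < Fintype.card α := Fintype.one_lt_card_iff.2 ⟨_, _, fun h => hc (congrArg some h)⟩
    omega
  obtain ⟨S, hS0, hSs⟩ : ∃ S : ℕ → Finset (List α), S 0 = {[]} ∧
      ∀ k, S (k+1) = ((S k).biUnion (fun u => E u (g k))).filter SqFree :=
    ⟨fun k => Nat.rec {[]} (fun k Sk => (Sk.biUnion (fun u => E u (g k))).filter SqFree) k,
      rfl, fun _ => rfl⟩
  obtain ⟨P, hPdef⟩ : ∃ P : ℕ → ℕ, ∀ k, P k = ∑ j ∈ Finset.range k, (g j).length :=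
    ⟨_, fun _ => rfl⟩
  have hP0 : P 0 = 0 := by simp [hPdef]
  have hPs : ∀ k, P (k+1) = P k + (g k).length := by
    intro k; rw [hPdef, hPdef, Finset.sum_range_succ]
  have hmonoP : Monotone P := monotone_nat_of_le_succ (fun n => by rw [hPs]; omega)
  have hSprop : ∀ k, ∀ s ∈ S k, s ∈ L ∧ SqFree s ∧ s.length = P k ∧ CompatInf s μ := by
    intro k
    induction k with
    | zero =>
      intro s hs
      rw [hS0, Finset.mem_singleton] at hs
      subst hs
      refine ⟨hI, ?_, by simp [hP0], ?_⟩
      · intro v hv h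
        have h1 := h.length_le
        have h2 := List.length_pos_iff.2 hv
        rw [List.length_append, List.length_nil] at h1
        omega
      · intro i hi
        simp at hi
    | succ k ih =>
      intro s hs
      rw [hSs, Finset.mem_filter, Finset.mem_biUnion] at hs
      obtain ⟨⟨u, hu, hs⟩, hsq⟩ := hs
      obtain ⟨huL, husq, hul, huc⟩ := ih u hu
      obtain ⟨hsL, v, rfl, hv, hvc⟩ := (hE u (g k) huL (hg k)).2 s hs
      refine ⟨hsL, hsq, by rw [List.length_append, hul, hv, hPs], ?_⟩
      intro i hi a ha
      by_cases hiu : i < u.length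
      · rw [List.getElem?_append_left hiu]
        exact huc i hiu a ha
      · rw [List.getElem?_append_right (by omega)]
        rw [List.length_append] at hi
        apply hvc.2 (i - u.length) (by omega)
        rw [hgμ k (i - u.length) (by omega), ← hPdef, ← hul, ← ha]
        congr 2; omega
  obtain ⟨X, hXdef⟩ : ∃ X : ℕ → Finset (List α), ∀ k, X k = (S k).biUnion (fun u => E u (g k)) :=
    ⟨_, fun _ => rfl⟩
  have hXmem : ∀ k, ∀ s ∈ X k, s ∈ L ∧ s.length = P (k+1) ∧ s.take (P k) ∈ S k ∧
      s ∈ E (s.take (P k)) (g k) := by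
    intro k s hs
    rw [hXdef, Finset.mem_biUnion] at hs
    obtain ⟨u, hu, hs⟩ := hs
    obtain ⟨huL, husq, hul, huc⟩ := hSprop k u hu
    obtain ⟨hsL, v, rfl, hv, hvc⟩ := (hE u (g k) huL (hg k)).2 s hs
    have ht : (u ++ v).take (P k) = u := by rw [← hul]; simp
    rw [ht]
    exact ⟨hsL, by rw [List.length_append, hul, hv, hPs], hu, hs⟩
  have hStake : ∀ k, ∀ j ≤ k, ∀ s ∈ S k, s.take (P j) ∈ S j := by
    intro k
    induction k with
    | zero =>
      intro j hj s hs
      obtain rfl : j = 0 := by omega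
      rw [List.take_of_length_le (by rw [(hSprop 0 s hs).2.2.1])]
      exact hs
    | succ k ih =>
      intro j hj s hs
      rcases Nat.lt_or_ge j (k+1) with h | h
      · have hs' : s ∈ X k := by
          rw [hXdef]; rw [hSs] at hs; exact (Finset.mem_filter.1 hs).1
        have h1 := ih j (by omega) _ (hXmem k s hs').2.2.1
        rwa [List.take_take, min_eq_left (hmonoP (by omega))] at h1
      · obtain rfl : j = k + 1 := by omega
        rw [List.take_of_length_le (by rw [(hSprop _ s hs).2.2.1])]
        exact hs
  have hXtake : ∀ k, ∀ s ∈ X k, ∀ j ≤ k, s.take (P j) ∈ S j := by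
    intro k s hs j hj
    have h1 := hStake k j hj _ (hXmem k s hs).2.2.1
    rwa [List.take_take, min_eq_left (hmonoP hj)] at h1
  have hCand : ∀ k, Cand (X k) (P (k+1)) (g k).length (f (g k).length) := by
    intro k
    have hk : P (k+1) - (g k).length = P k := by rw [hPs]; omega
    refine ⟨hlpos _ (hg k), by rw [hPs]; omega, fun s hs => (hXmem k s hs).2.1,
      fun s hs => hcons s (hXmem k s hs).1, ?_⟩
    intro u
    rw [hk]
    by_cases hu : u ∈ S k
    · rw [← (hE u (g k) (hSprop k u hu).1 (hg k)).1]
      apply Finset.card_le_card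
      intro s hs
      obtain ⟨h1, rfl⟩ := Finset.mem_filter.1 hs
      exact (hXmem k s h1).2.2.2
    · rw [Finset.filter_eq_empty_iff.2]
      · simp
      · rintro s hs rfl
        exact hu (hXmem k s hs).2.2.1
  have hXcard : ∀ k, (X k).card = (S k).card * f (g k).length := by
    intro k
    rw [hXdef, Finset.card_biUnion, Finset.sum_congr rfl
      (fun u hu => (hE u (g k) (hSprop k u hu).1 (hg k)).1)]
    · simp
    · intro u hu u' hu' hne
      rw [Function.onFun, Finset.disjoint_left]
      intro s hs hs'
      apply hne
      obtain ⟨huL, -, hul, -⟩ := hSprop k u hu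
      obtain ⟨huL', -, hul', -⟩ := hSprop k u' hu'
      obtain ⟨-, v, rfl, -⟩ := (hE u (g k) huL (hg k)).2 s hs
      obtain ⟨-, v', h, -⟩ := (hE u' (g k) huL' (hg k)).2 _ hs'
      exact (List.append_inj h (by rw [hul, hul'])).1
  -- the main growth estimate
  have hgrow : ∀ k, ((S k).card : ℝ) ≤ x (g k).length * (S (k+1)).card := by
    intro k
    induction k using Nat.strong_induction_on with
    | _ k ih =>
    have hxk := hx _ (hg k)
    have hSX : (S (k+1)).card + ((X k).filter (fun s => ¬ SqFree s)).card
        = (S k).card * f (g k).length := by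
      rw [← hXcard, hSs, ← hXdef]
      exact Finset.card_filter_add_card_filter_not _
    have hSXr : ((S (k+1)).card : ℝ) + ((X k).filter (fun s => ¬ SqFree s)).card
        = (S k).card * f (g k).length := by exact_mod_cast hSX
    have hSk0 : (0:ℝ) ≤ (S k).card := Nat.cast_nonneg _
    have halpha0 : ∀ a b, (0:ℝ) ≤ (alphaA (Fintype.card α) f a b : ℝ) := fun _ _ => Nat.cast_nonneg _
    have halpha0' : ∀ a b, (0:ℝ) ≤ (alphaA' (Fintype.card α) f a b : ℝ) :=
      fun _ _ => Nat.cast_nonneg _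
    suffices h : (x (g k).length)⁻¹ * (S k).card ≤ (S (k+1)).card by
      rwa [inv_mul_le_iff₀ hxk.1] at h
    rcases step_bound S (fun k => (g k).length) P f p k (X k) hq hP0 hPs
      (fun k => hp _ (hg k)) hp2 (fun j s hs => ⟨(hSprop j s hs).2.1, (hSprop j s hs).2.2.1⟩)
      (hCand k) (hXtake k) (fun s hs => hIII s (hXmem k s hs).1)
      ((X k).filter (fun s => ¬ SqFree s)) (Finset.filter_subset _ _)
      (fun s hs => (Finset.mem_filter.1 hs).2) with h0 | ⟨J, hJk, r, hr1, hr2, hr3, hB⟩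
    · rw [h0] at hSXr
      simp only [Finset.card_empty, Nat.cast_zero, add_zero] at hSXr
      rw [hSXr, mul_comm]
      apply mul_le_mul_of_nonneg_left _ hSk0
      have h1 := hmain _ (hg k) _ (hg k) _ (hg k) 1 le_rfl (hlpos _ (hg k))
      have h2 := hp _ (hg k)
      have h3 := (hβrange (1 + p - (g k).length - (g k).length)
        (by have := hlpos _ (hg k); omega)).1
      have h4 : 0 ≤ β (1 + p - (g k).length - (g k).length) *
          ((alphaA' (Fintype.card α) f 1 (g k).length : ℝ) +
            x (g k).length * (alphaA (Fintype.card α) f (g k).length (g k).length : ℝ)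
              / (1 - x (g k).length)) := by
        apply mul_nonneg h3
        apply add_nonneg (halpha0' _ _)
        apply div_nonneg (mul_nonneg hxk.1.le (halpha0 _ _))
        linarith [hxk.2]
      linarith
    · obtain ⟨u, hu, humax⟩ := Finset.exists_max_image W
        (fun u => (alphaA (Fintype.card α) f u.length (g k).length : ℝ) / (1 - x u.length)) hWne
      set A : ℝ := (alphaA (Fintype.card α) f u.length (g k).length : ℝ) / (1 - x u.length) with hA
      have hA0 : 0 ≤ A := div_nonneg (halpha0 _ _) (by linarith [(hx u hu).2])
      have hAle : ∀ j, (alphaA (Fintype.card α) f (g j).length (g k).length : ℝ)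
          ≤ A * (1 - x (g j).length) := by
        intro j
        have h1 := humax _ (hg j)
        rwa [div_le_iff₀ (by linarith [(hx _ (hg j)).2])] at h1
      have hsum : ∀ m ≤ k, ∑ j ∈ Finset.range m, ((S (j+1)).card : ℝ) *
          alphaA (Fintype.card α) f (g j).length (g k).length ≤ A * (S m).card := by
        intro m
        induction m with
        | zero => intro _; simpa using mul_nonneg hA0 (Nat.cast_nonneg _)
        | succ m ihm =>
          intro hm
          rw [Finset.sum_range_succ]
          have h1 := ihm (by omega)
          have h2 := mul_le_mul_of_nonneg_left (ih m (by omega)) hA0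
          have h3 := mul_le_mul_of_nonneg_left (hAle m)
            (Nat.cast_nonneg (α := ℝ) (S (m+1)).card)
          nlinarith
      have hprod : ∀ m, J + 1 ≤ m → m ≤ k → ((S (J+1)).card : ℝ) ≤
          (∏ i ∈ Finset.Ico (J+1) m, x (g i).length) * (S m).card := by
        intro m hm
        induction m, hm using Nat.le_induction with
        | base => intro _; simp
        | succ m hm ihm =>
          intro hmk
          rw [Finset.prod_Ico_succ_top hm, mul_assoc]
          refine (ihm (by omega)).trans (mul_le_mul_of_nonneg_left (ih m (by omega)) ?_)
          exact Finset.prod_nonneg (fun i _ => (hx _ (hg i)).1.le)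
      have hPk := hPs k
      have hPJ := hPs J
      have hlk := hp _ (hg k)
      have hlJ := hp _ (hg J)
      have hlen : ∑ i ∈ Finset.Ico (J+1) k, (g i).length
          = r + p - (g k).length - (g J).length := by
        have h1 := Finset.sum_range_add_sum_Ico (fun i => (g i).length) (show J + 1 ≤ k by omega)
        rw [← hPdef, ← hPdef] at h1
        omega
      have hle : ∑ i ∈ Finset.Ico (J+1) k, (g i).length ≤ p := by
        rw [hlen]; omega
      have hbeta := prod_le_beta W p x β hx hβ g hg (Finset.Ico (J+1) k) hle
      rw [hlen] at hbeta
      have h1 := hmain _ (hg k) u hu _ (hg J) r hr1 hr2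
      have hB' : (((X k).filter (fun s => ¬ SqFree s)).card : ℝ) ≤
          (S (J+1)).card * alphaA' (Fintype.card α) f r (g k).length +
          ∑ j ∈ Finset.range J, ((S (j+1)).card : ℝ) *
            alphaA (Fintype.card α) f (g j).length (g k).length := by exact_mod_cast hB
      have h2 := hsum J hJk.le
      have h3 := mul_le_mul_of_nonneg_left (ih J hJk) hA0
      rw [mul_div_assoc, ← hA] at h1
      set D : ℝ := (alphaA' (Fintype.card α) f r (g k).length : ℝ) + x (g J).length * A with hD
      have hD0 : 0 ≤ D := add_nonneg (halpha0' _ _) (mul_nonneg (hx _ (hg J)).1.le hA0)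
      have h4 : (((X k).filter (fun s => ¬ SqFree s)).card : ℝ) ≤ (S (J+1)).card * D := by
        rw [hD]; nlinarith
      have h5 : ((S (J+1)).card : ℝ) ≤ β (r + p - (g k).length - (g J).length) * (S k).card :=
        (hprod k (by omega) le_rfl).trans (mul_le_mul_of_nonneg_right hbeta hSk0)
      have h6 := mul_le_mul_of_nonneg_right h5 hD0
      have h7 := mul_le_mul_of_nonneg_right h1 hSk0
      nlinarith
  have hpos : ∀ k, 0 < (S k).card := by
    intro k
    induction k with
    | zero => rw [hS0]; simp
    | succ k ih =>
      rcases Nat.eq_zero_or_pos (S (k+1)).card with h | h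
      · have := hgrow k
        rw [h] at this
        have h2 : (0:ℝ) < (S k).card := by exact_mod_cast ih
        simp at this
        rw [this] at ih
        simp at ih
      · exact h
  have hPge : ∀ k, k ≤ P k := by
    intro k
    induction k with
    | zero => omega
    | succ k ih =>
      have := hlpos _ (hg k)
      rw [hPs]; omega
  intro hfin
  have hfin2 := hfin.image List.length
  obtain ⟨M, hM⟩ := hfin2.bddAbove
  obtain ⟨s, hs⟩ := Finset.card_pos.1 (hpos (M+1))
  obtain ⟨-, h1, h2, h3⟩ := hSprop _ s hs
  have h4 := hM (Set.mem_image_of_mem List.length (show s ∈ {v : List α | SqFree v ∧ CompatInf v μ} from ⟨h1, h3⟩))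
  have h5 := hPge (M+1)
  omega
end

section
/- Let Σ = {0,1,2} be a three-letter alphabet. For every sequence v_1, v_2, v_3, … of letters of Σ and every strictly increasing sequence of positive integers p_1 < p_2 < p_3 < … such that p_{i+1} − p_i ≥ 19 for all i ≥ 1, there exists an infinite square-free word u = u_1 u_2 u_3 … over Σ such that u_{p_i} = v_i for all i ≥ 1. (In other words, d({0,1,2}) ≤ 19.) -/
/-- An infinite word `u` (positions indexed from 1) is square-free: it has no factor
`u_i … u_{i+n-1} u_{i+n} … u_{i+2n-1}` with the two halves equal. -/
def SqFreeSeq {α : Type*} (u : ℕ → α) : Prop :=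
  ∀ i n : ℕ, 1 ≤ i → 1 ≤ n → ∃ k, k < n ∧ u (i + k) ≠ u (i + n + k)

namespace TT

def dLET : ℕ := 1018442137805951604693538356468267096667510294953423572222902442587808861038236192613847118529583070860784341105956655518045082848172890315465789132542112562778009635267334281258371868980253096912069691404662026342033030201508838297036364147222426015186847455491592204312333665845519344501099587409100684918183965106231962803542240360136918602366538258906481892106233388713538067805102734518684714146698356037021144510065198547916444524983681436077808160210238298320290264390757863873728245409653440469180649963878030687985369210036357436780261540452712505821582885648417695761420219808687998500
def dLEN : ℕ := 455540378931325274143410410206591722115761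
def dEDG : ℕ := 101742729757609273587738688285845189717704826237329025752489235916187766677439155750104617018858166187704657518089242052829526032801297126186247988424763041962113459517834618391323655610310495682199332785300563732675342770244629517172735
def dWTS : ℕ := 14173223410715037238332447485396333374121603974540599625715544914374520588290261850594757625760288159296670593020816638516163296045018798790971039276430285193125486639402969743860886239937692165163770654194105035016428221337641783571172539246258868723234759400297896164792103822609040318922805245133542492746737570532194438583100666542760
def dSMS : ℕ := 14168602118321164447916704111090427928005077343994188791100389080108839585019993890971705620865993535134569421207720019522782311686914863183940801633531927086367732304825991490924756725370025137667871486717503266911865513049487777914589054049913987212179865916104266675506503581805005901987628605863929334652881879225809741849970551552680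
def dFHS : ℕ := 8114707132152068479509942
def dBHS : ℕ := 1297318247389038082

def allN (n : ℕ) (f : ℕ → Bool) : Bool := Nat.rec true (fun k r => f k && r) n
def anyN (n : ℕ) (f : ℕ → Bool) : Bool := Nat.rec false (fun k r => f k || r) n

theorem allN_spec {n : ℕ} {f : ℕ → Bool} (h : allN n f = true) : ∀ k, k < n → f k = true := by
  induction n with
  | zero => intro k hk; omega
  | succ n ih =>
    have h' : (f n && allN n f) = true := h
    rw [Bool.and_eq_true] at h'
    intro k hk
    rcases Nat.lt_succ_iff_lt_or_eq.mp hk with hk | rfl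
    · exact ih h'.2 k hk
    · exact h'.1

theorem anyN_spec {n : ℕ} {f : ℕ → Bool} (h : anyN n f = true) : ∃ k, k < n ∧ f k = true := by
  induction n with
  | zero => exact absurd (show false = true from h) Bool.false_ne_true
  | succ n ih =>
    have h' : (f n || anyN n f) = true := h
    rw [Bool.or_eq_true] at h'
    rcases h' with h' | h'
    · exact ⟨n, Nat.lt_succ_self n, h'⟩
    · obtain ⟨k, hk, hf⟩ := ih h'
      exact ⟨k, by omega, hf⟩

def imp (a b : Bool) : Bool := cond a b true

theorem imp_spec {a b : Bool} (h : imp a b = true) (ha : a = true) : b = true := by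
  subst ha; exact h

def sel (a b : ℕ) : ℕ := cond (Nat.ble a b) a b

def ltr (c x : ℕ) : ℕ := Nat.mod (Nat.div dLET (Nat.pow 4 (Nat.add (Nat.mul 36 c) x))) 4
def ln (c : ℕ) : ℕ := Nat.mod (Nat.div dLEN (Nat.pow 32 c)) 32
def fh (c : ℕ) : ℕ := Nat.mod (Nat.div dFHS (Nat.pow 8 c)) 8
def bh (c : ℕ) : ℕ := Nat.mod (Nat.div dBHS (Nat.pow 8 c)) 8
def edge (c c' : ℕ) : Bool :=
  Nat.beq (Nat.mod (Nat.div dEDG (Nat.pow 2 (Nat.add (Nat.mul 28 c) c'))) 2) 1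
def Wt (c d : ℕ) : ℕ :=
  Nat.mod (Nat.div dWTS (Nat.pow 4 (Nat.add (Nat.mul 20 c) (sel d 19)))) 4
def Sm (c d : ℕ) : ℕ :=
  Nat.mod (Nat.div dSMS (Nat.pow 4 (Nat.add (Nat.mul 20 c) (sel d 19)))) 4

def tau (x : ℕ) : ℕ := cond (Nat.beq x 0) 1 (cond (Nat.beq x 1) 0 x)
def mk (x : ℕ) : ℕ := ltr 0 x

def bne (a b : ℕ) : Bool := cond (Nat.beq a b) false true

def chk1 : Bool := allN 28 fun c => Nat.ble 8 (ln c) && (Nat.ble (ln c) 26 &&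
  (allN 6 (fun x => Nat.beq (ltr c x) (mk x) && Nat.beq (ltr c (Nat.add (ln c) x)) (tau (mk x))) &&
   (allN 36 (fun x => Nat.ble (ltr c x) 2) && Nat.ble (fh c) 6)))
def chk2 : Bool := allN 28 fun c => allN (Nat.sub (ln c) 1) fun x =>
  anyN 6 (fun y => bne (ltr c (Nat.add (Nat.succ x) y)) (mk y)) &&
  anyN 6 (fun y => bne (ltr c (Nat.add (Nat.succ x) y)) (tau (mk y)))
def chk3 : Bool := allN 28 fun c => allN 17 fun p => allN 32 fun i =>
  imp (Nat.ble 1 p && Nat.ble (Nat.add i (Nat.add p p)) (Nat.add (ln c) 6))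
    (anyN p fun y => bne (ltr c (Nat.add i y)) (ltr c (Nat.add (Nat.add i p) y)))
def chk4 : Bool := allN 28 fun c => allN 28 fun c' => imp (edge c c')
  (Nat.blt (bh c') (fh c) &&
  allN 5 fun x => allN 32 fun p =>
  imp (Nat.ble 1 p && (Nat.ble p (Nat.add (ln c) (Nat.succ x)) &&
      Nat.ble (Nat.add p (Nat.succ x)) (Nat.add (ln c') 6)))
    (anyN p fun y => bne (ltr c (Nat.add (Nat.sub (Nat.add (ln c) (Nat.succ x)) p) y))
      (tau (ltr c' (Nat.add (Nat.succ x) y)))))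
def chk5 : Bool := allN 28 fun c => allN 28 fun c' => imp (bne c c')
  (anyN (sel (Nat.sub (Nat.add (ln c) 7) (fh c)) (Nat.add (ln c') 6))
     fun y => bne (ltr c y) (ltr c' y))
def chk6 : Bool := allN 28 fun c => allN 28 fun c' => imp (bne c c')
  (imp (Nat.ble (Nat.add (ln c) (Nat.succ (bh c))) (Nat.add (ln c') 6))
  (anyN (Nat.add (ln c) (Nat.succ (bh c)))
     fun y => bne (ltr c (Nat.sub (Nat.add (ln c) 5) y)) (ltr c' (Nat.sub (Nat.add (ln c') 5) y))))
def Cc (d v c : ℕ) : ℕ :=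
  cond (Nat.ble (ln c) d) (Wt c (Nat.sub d (ln c)))
   (cond (Nat.ble (ln c) (Nat.add d 19))
     (cond (Nat.beq (ltr c (Nat.add 6 d)) v) (Sm c (Nat.sub (Nat.add d 19) (ln c))) 0) 0)
def sumE (c0 d v n : ℕ) : ℕ :=
  Nat.rec 0 (fun c r => Nat.add r (cond (edge c0 c) (Cc d v c) 0)) n
def chk7 : Bool := allN 28 fun c0 => allN 46 fun d => allN 3 fun v =>
  imp (bne (Wt c0 d) 0) (Nat.ble (Nat.mul 4 (Wt c0 d)) (sumE c0 d v 28))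
def chk8 : Bool := allN 28 fun c => Nat.beq (Wt c 19) 3 && allN 20 fun d => bne (Wt c d) 1 &&
  (Nat.ble (Sm c d) (Wt c d) && Nat.ble (Sm c d) (Sm c (Nat.succ d)))

theorem chk1_ok : chk1 = true := by decide +kernel
theorem chk2_ok : chk2 = true := by decide +kernel
theorem chk3_ok : chk3 = true := by decide +kernel
theorem chk4_ok : chk4 = true := by decide +kernel
theorem chk5_ok : chk5 = true := by decide +kernel
theorem chk6_ok : chk6 = true := by decide +kernel
theorem chk7_ok : chk7 = true := by decide +kernel
theorem chk8_ok : chk8 = true := by decide +kernel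

theorem ble_t {a b : ℕ} : Nat.ble a b = true ↔ a ≤ b := iff_of_eq Nat.ble_eq
theorem ble_f {a b : ℕ} : Nat.ble a b = false ↔ b < a := by
  rw [← not_iff_not, Bool.not_eq_false, Nat.ble_eq]; omega
theorem beq_t {a b : ℕ} : Nat.beq a b = true ↔ a = b := iff_of_eq Nat.beq_eq
theorem beq_f {a b : ℕ} : Nat.beq a b = false ↔ a ≠ b := by
  rw [← not_iff_not, Bool.not_eq_false, Nat.beq_eq]; simp
theorem bne_t {a b : ℕ} : bne a b = true ↔ a ≠ b := by
  unfold bne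
  cases h : Nat.beq a b
  · simpa using beq_f.mp h
  · simpa using beq_t.mp h
theorem sel_eq (a b : ℕ) : sel a b = min a b := by
  unfold sel
  cases h : Nat.ble a b
  · have := ble_f.mp h
    simp; omega
  · have := ble_t.mp h
    simp; omega

theorem spec1 {c : ℕ} (hc : c < 28) : 8 ≤ ln c ∧ ln c ≤ 26 ∧
    (∀ x, x < 6 → ltr c x = mk x ∧ ltr c (ln c + x) = tau (mk x)) ∧
    (∀ x, x < 36 → ltr c x ≤ 2) ∧ fh c ≤ 6 := by
  have h := allN_spec chk1_ok c hc
  simp only [Bool.and_eq_true, ble_t] at h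
  obtain ⟨h1, h2, h3, h4, h5⟩ := h
  refine ⟨h1, h2, ?_, ?_, h5⟩
  · intro x hx
    have := allN_spec h3 x hx
    simp only [Bool.and_eq_true, beq_t] at this
    exact this
  · intro x hx
    exact ble_t.mp (allN_spec h4 x hx)

theorem spec2 {c : ℕ} (hc : c < 28) {x : ℕ} (h0 : 0 < x) (hx : x < ln c) :
    (∃ y, y < 6 ∧ ltr c (x + y) ≠ mk y) ∧ (∃ y, y < 6 ∧ ltr c (x + y) ≠ tau (mk y)) := by
  obtain ⟨z, rfl⟩ : ∃ z, x = z + 1 := ⟨x - 1, by omega⟩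
  have h := allN_spec (allN_spec chk2_ok c hc) z (show z < ln c - 1 by omega)
  simp only [Bool.and_eq_true] at h
  obtain ⟨h1, h2⟩ := h
  obtain ⟨y, hy, e⟩ := anyN_spec h1
  obtain ⟨y', hy', e'⟩ := anyN_spec h2
  exact ⟨⟨y, hy, bne_t.mp e⟩, ⟨y', hy', bne_t.mp e'⟩⟩

theorem spec3 {c : ℕ} (hc : c < 28) {p i : ℕ} (hp : 1 ≤ p) (h : i + (p + p) ≤ ln c + 6) :
    ∃ y, y < p ∧ ltr c (i + y) ≠ ltr c (i + p + y) := by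
  have := (spec1 hc).2.1
  have h3 := allN_spec (allN_spec (allN_spec chk3_ok c hc) p (by omega)) i (by omega)
  have h4 := imp_spec h3 (by rw [Bool.and_eq_true, ble_t, ble_t]; exact ⟨hp, h⟩)
  obtain ⟨y, hy, e⟩ := anyN_spec h4
  exact ⟨y, hy, bne_t.mp e⟩

theorem spec4a {c c' : ℕ} (hc : c < 28) (hc' : c' < 28) (he : edge c c' = true) :
    bh c' < fh c := by
  have h3 := imp_spec (allN_spec (allN_spec chk4_ok c hc) c' hc') he
  rw [Bool.and_eq_true] at h3
  exact ble_t.mp h3.1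

theorem spec4 {c c' : ℕ} (hc : c < 28) (hc' : c' < 28) (he : edge c c' = true) {x p : ℕ}
    (hx0 : 0 < x) (hx : x < 6) (hp : 1 ≤ p) (h1 : p ≤ ln c + x) (h2 : p + x ≤ ln c' + 6) :
    ∃ y, y < p ∧ ltr c (ln c + x - p + y) ≠ tau (ltr c' (x + y)) := by
  have := (spec1 hc').2.1
  obtain ⟨z, rfl⟩ : ∃ z, x = z + 1 := ⟨x - 1, by omega⟩
  have h3 := imp_spec (allN_spec (allN_spec chk4_ok c hc) c' hc') he
  rw [Bool.and_eq_true] at h3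
  have h4 := allN_spec (allN_spec h3.2 z (by omega)) p (by omega)
  have h5 := imp_spec h4 (by
    rw [Bool.and_eq_true, Bool.and_eq_true, ble_t, ble_t, ble_t]; exact ⟨hp, h1, h2⟩)
  obtain ⟨y, hy, e⟩ := anyN_spec h5
  exact ⟨y, hy, bne_t.mp e⟩

theorem spec5 {c c' : ℕ} (hc : c < 28) (hc' : c' < 28) (hn : c ≠ c') :
    ∃ y, y < ln c + 7 - fh c ∧ y < ln c' + 6 ∧ ltr c y ≠ ltr c' y := by
  have h3 := imp_spec (allN_spec (allN_spec chk5_ok c hc) c' hc') (bne_t.mpr hn)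
  obtain ⟨y, hy, e⟩ := anyN_spec h3
  rw [sel_eq] at hy
  have hy' : y < min (ln c + 7 - fh c) (ln c' + 6) := hy
  exact ⟨y, by omega, by omega, bne_t.mp e⟩

theorem spec6 {c c' : ℕ} (hc : c < 28) (hc' : c' < 28) (hn : c ≠ c')
    (hl : ln c + (bh c + 1) ≤ ln c' + 6) :
    ∃ y, y < ln c + (bh c + 1) ∧ ltr c (ln c + 5 - y) ≠ ltr c' (ln c' + 5 - y) := by
  have h3 := imp_spec (allN_spec (allN_spec chk6_ok c hc) c' hc') (bne_t.mpr hn)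
  have h4 := imp_spec h3 (ble_t.mpr hl)
  obtain ⟨y, hy, e⟩ := anyN_spec h4
  exact ⟨y, hy, bne_t.mp e⟩

theorem tau_tau (x : ℕ) : tau (tau x) = x := by
  match x with
  | 0 => rfl
  | 1 => rfl
  | n + 2 => rfl

theorem tau_inj {a b : ℕ} (h : tau a = tau b) : a = b := by
  rw [← tau_tau a, h, tau_tau]

theorem tau_le {a : ℕ} (h : a ≤ 2) : tau a ≤ 2 := by
  interval_cases a <;> decide

def ori (n x : ℕ) : ℕ := if n % 2 = 0 then x else tau x

theorem ori_inj {n a b : ℕ} (h : ori n a = ori n b) : a = b := by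
  unfold ori at h
  split at h
  · exact h
  · exact tau_inj h

theorem ori_succ (n x : ℕ) : ori (n + 1) x = ori n (tau x) := by
  unfold ori
  split <;> split
  · omega
  · rw [tau_tau]
  · rfl
  · omega

theorem ori_par {n n' : ℕ} (h : n % 2 = n' % 2) (x : ℕ) : ori n x = ori n' x := by
  unfold ori; rw [h]

theorem ori_npar {n n' : ℕ} (h : n % 2 ≠ n' % 2) (x : ℕ) : ori n x = ori n' (tau x) := by
  rw [← ori_succ]; exact ori_par (by omega) x

theorem ori_le (n : ℕ) {x : ℕ} (h : x ≤ 2) : ori n x ≤ 2 := by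
  unfold ori; split
  · exact h
  · exact tau_le h

def ps (b : ℕ → ℕ) : ℕ → ℕ
  | 0 => 0
  | n + 1 => ps b n + ln (b n)

def idx (b : ℕ → ℕ) (y : ℕ) : ℕ := Nat.findGreatest (fun n => ps b n ≤ y) y

def U (b : ℕ → ℕ) (y : ℕ) : ℕ := ori (idx b y) (ltr (b (idx b y)) (y - ps b (idx b y)))

section word
variable {b : ℕ → ℕ} (hb : ∀ n, b n < 28)
include hb

theorem ps_succ (n : ℕ) : ps b n + 8 ≤ ps b (n + 1) := by
  have := (spec1 (hb n)).1
  show ps b n + 8 ≤ ps b n + ln (b n)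
  omega

theorem ps_mono : StrictMono (ps b) := strictMono_nat_of_lt_succ fun n => by
  have := ps_succ hb n; omega

theorem ps_lt {m n : ℕ} (h : m < n) : ps b m + 8 ≤ ps b n := by
  have h1 := ps_succ hb m
  have h2 := (ps_mono hb).monotone (show m + 1 ≤ n from h)
  omega

theorem idx_eq {n y : ℕ} (h1 : ps b n ≤ y) (h2 : y < ps b (n + 1)) : idx b y = n := by
  unfold idx
  rw [Nat.findGreatest_eq_iff]
  refine ⟨le_trans (ps_mono hb).le_apply h1, fun _ => h1, ?_⟩
  intro k hk _ hk2
  have := (ps_mono hb).monotone (show n + 1 ≤ k from hk)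
  omega

theorem ex_idx (y : ℕ) : ∃ n, ps b n ≤ y ∧ y < ps b (n + 1) := by
  induction y with
  | zero =>
    refine ⟨0, le_refl _, ?_⟩
    have := ps_succ hb 0; omega
  | succ y ih =>
    obtain ⟨n, h1, h2⟩ := ih
    by_cases h : y + 1 < ps b (n + 1)
    · exact ⟨n, by omega, h⟩
    · have := ps_succ hb (n + 1)
      exact ⟨n + 1, by omega, by omega⟩

theorem U_eq {n x : ℕ} (hx : x < ln (b n) + 6) : U b (ps b n + x) = ori n (ltr (b n) x) := by
  by_cases h : x < ln (b n)
  · have : idx b (ps b n + x) = n := idx_eq hb (by omega) (by show _ < ps b n + ln (b n); omega)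
    unfold U
    rw [this]; simp
  · obtain ⟨z, rfl⟩ : ∃ z, x = ln (b n) + z := ⟨x - ln (b n), by omega⟩
    have hz : z < 6 := by omega
    have e : ps b n + (ln (b n) + z) = ps b (n + 1) + z := by
      show _ = ps b n + ln (b n) + z; omega
    have : idx b (ps b (n + 1) + z) = n + 1 :=
      idx_eq hb (by omega) (by have := ps_succ hb (n + 1); omega)
    rw [e]
    unfold U
    rw [this, ori_succ]
    simp only [Nat.add_sub_cancel_left]
    rw [((spec1 (hb (n + 1))).2.2.1 z hz).1, ((spec1 (hb n)).2.2.1 z hz).2]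

theorem U_mk (n : ℕ) {x : ℕ} (hx : x < 6) : U b (ps b n + x) = ori n (mk x) := by
  rw [U_eq hb (by omega), ((spec1 (hb n)).2.2.1 x hx).1]

theorem marker {y n : ℕ} (h : ∀ x, x < 6 → U b (y + x) = ori n (mk x)) :
    ∃ n', y = ps b n' ∧ n' % 2 = n % 2 := by
  obtain ⟨n', h1, h2⟩ := ex_idx hb y
  have h2' : y < ps b n' + ln (b n') := h2
  obtain ⟨z, rfl⟩ : ∃ z, y = ps b n' + z := ⟨y - ps b n', by omega⟩
  have hz : z < ln (b n') := by omega
  have h3 : ∀ x, x < 6 → ori n' (ltr (b n') (z + x)) = ori n (mk x) := by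
    intro x hx
    rw [← h x hx, Nat.add_assoc, U_eq hb (by omega)]
  by_cases hp : n' % 2 = n % 2
  · refine ⟨n', ?_, hp⟩
    by_contra hne
    have hz0 : 0 < z := by omega
    obtain ⟨y, hy, e⟩ := (spec2 (hb n') hz0 hz).1
    have := h3 y hy
    rw [ori_par hp] at this
    exact e (ori_inj this)
  · exfalso
    have h4 : ∀ x, x < 6 → ltr (b n') (z + x) = tau (mk x) := by
      intro x hx
      have := h3 x hx
      rw [ori_npar hp] at this
      rw [← tau_tau (ltr (b n') (z + x)), ori_inj this]
    by_cases hz0 : z = 0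
    · subst hz0
      have h5 := h4 0 (by omega)
      rw [Nat.zero_add, ((spec1 (hb n')).2.2.1 0 (by omega)).1] at h5
      exact absurd h5 (by decide)
    · obtain ⟨y, hy, e⟩ := (spec2 (hb n') (by omega) hz).2
      exact e (h4 y hy)

theorem U_le (y : ℕ) : U b y ≤ 2 := by
  obtain ⟨n, h1, h2⟩ := ex_idx hb y
  have h2' : y < ps b n + ln (b n) := h2
  obtain ⟨z, rfl⟩ : ∃ z, y = ps b n + z := ⟨y - ps b n, by omega⟩
  have := (spec1 (hb n)).2.1
  rw [U_eq hb (by omega)]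
  exact ori_le _ ((spec1 (hb n)).2.2.2.1 _ (by omega))

theorem sq_free (he : ∀ n, edge (b n) (b (n + 1)) = true)
    (np : ∀ s k, 2 ≤ k → k % 2 = 0 → ¬ ∀ x, x + 1 < k → b (s + x) = b (s + k + x))
    (i p : ℕ) (hp : 1 ≤ p) (hsq : ∀ x, x < p → U b (i + x) = U b (i + p + x)) : False := by
  have sh : ∀ y, i ≤ y → y < i + p → U b y = U b (y + p) := by
    intro y h1 h2
    have := hsq (y - i) (by omega)
    rw [show i + (y - i) = y by omega, show i + p + (y - i) = y + p by omega] at this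
    exact this
  by_cases hm : ∃ n, i ≤ ps b n ∧ ps b n + 6 ≤ i + p
  · obtain ⟨a, ha1, ha2, hamin⟩ : ∃ a, i ≤ ps b a ∧ ps b a + 6 ≤ i + p ∧ ∀ n, n < a → ps b n < i := by
      obtain ⟨n, hn1, hn2⟩ := hm
      have hex : ∃ n, i ≤ ps b n := ⟨n, hn1⟩
      classical
      refine ⟨Nat.find hex, Nat.find_spec hex, ?_, ?_⟩
      · have := (ps_mono hb).monotone (Nat.find_min' hex hn1)
        omega
      · intro m hm
        have := Nat.find_min hex hm
        omega
    obtain ⟨n', hn', hpar⟩ : ∃ n', ps b a + p = ps b n' ∧ n' % 2 = a % 2 := by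
      apply marker hb
      intro x hx
      rw [← U_mk hb a hx, sh (ps b a + x) (by omega) (by omega)]
      congr 1; omega
    have hlt : a < n' := by
      rw [← (ps_mono hb).lt_iff_lt]; omega
    obtain ⟨k, rfl⟩ : ∃ k, n' = a + (k + 2) := ⟨n' - a - 2, by omega⟩
    have hk2 : k % 2 = 0 := by omega
    have ht : ps b (a + (k + 1)) < i + p := by
      by_contra hcon
      have h1 := ps_lt hb (show a + (k + 1) < a + (k + 2) by omega)
      obtain ⟨n'', e, _⟩ := marker hb (y := ps b (a + (k + 1)) - p) (n := a + (k + 1)) (by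
        intro x hx
        rw [← U_mk hb _ hx, sh _ (by omega) (by omega)]
        congr 1; omega)
      have : n'' < a := by
        rw [← (ps_mono hb).lt_iff_lt]; omega
      have := hamin _ this
      omega
    have F : ∀ e, a ≤ e → ps b (e + 1) + 6 ≤ i + p + bh (b (e + 1)) →
        ps b e + p = ps b (e + (k + 2)) → b e = b (e + (k + 2)) := by
      intro e hae h1 h2
      by_contra hne
      obtain ⟨y, hy1, hy2, hy3⟩ := spec5 (hb _) (hb _) hne
      have h3 := spec4a (hb _) (hb _) (he e)
      have h4 : ps b (e + 1) = ps b e + ln (b e) := rfl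
      have h5 := (ps_mono hb).monotone hae
      have h6 := sh (ps b e + y) (by omega) (by omega)
      rw [U_eq hb (by omega), show ps b e + y + p = ps b (e + (k + 2)) + y by omega,
        U_eq hb hy2, ori_par (show (e + (k + 2)) % 2 = e % 2 by omega)] at h6
      exact hy3 (ori_inj h6)
    have ind : ∀ x, x ≤ k → ps b (a + x) + p = ps b (a + x + (k + 2)) ∧
        ∀ x', x' < x → b (a + x') = b (a + x' + (k + 2)) := by
      intro x
      induction x with
      | zero => intro _; exact ⟨hn', fun x' h => by omega⟩
      | succ x ih =>
        intro hx
        obtain ⟨h1, h2⟩ := ih (by omega)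
        have h3 := ps_lt hb (show a + x + 1 < a + (k + 1) by omega)
        have h4 := F (a + x) (by omega) (by omega) h1
        refine ⟨?_, ?_⟩
        · have e1 : ps b (a + (x + 1)) = ps b (a + x) + ln (b (a + x)) := rfl
          have e2 : ps b (a + (x + 1) + (k + 2)) =
              ps b (a + x + (k + 2)) + ln (b (a + x + (k + 2))) := by
            rw [show a + (x + 1) + (k + 2) = a + x + (k + 2) + 1 by omega]; rfl
          rw [e1, e2, ← h4]; omega
        · intro x' hx'
          rcases Nat.lt_succ_iff_lt_or_eq.mp hx' with h | rfl
          · exact h2 x' h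
          · exact h4
    obtain ⟨i1, i2⟩ := ind k (le_refl k)
    by_cases hc : ps b (a + (k + 1)) + 6 ≤ i + p + bh (b (a + (k + 1)))
    · have h4 := F (a + k) (by omega) hc i1
      refine np a (k + 2) (by omega) (by omega) ?_
      intro x hx
      rw [show a + (k + 2) + x = a + x + (k + 2) by omega]
      rcases Nat.lt_or_ge x k with h | h
      · exact i2 x h
      · have : x = k := by omega
        subst this; exact h4
    · have e1 : ps b (a + (k + 2)) = ps b (a + (k + 1)) + ln (b (a + (k + 1))) := rfl
      have l8 := (spec1 (hb (a + (k + 1)))).1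
      rcases Nat.eq_zero_or_pos a with h0 | h0
      · subst h0
        have : ps b 0 = 0 := rfl
        omega
      obtain ⟨s, rfl⟩ : ∃ s, a = s + 1 := ⟨a - 1, by omega⟩
      have e2 : ps b (s + 1) = ps b s + ln (b s) := rfl
      have e3 := hamin s (by omega)
      have hbh : bh (b (s + 1 + (k + 1))) < 6 := by
        have h1 := spec4a (hb _) (hb _) (he (s + 1 + k))
        have h2 := (spec1 (hb (s + 1 + k))).2.2.2.2
        have : bh (b (s + 1 + (k + 1))) = bh (b (s + 1 + k + 1)) := rfl
        omega
      have hB : b (s + 1 + (k + 1)) = b s := by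
        by_contra hne
        obtain ⟨y, hy, hy3⟩ := spec6 (hb _) (hb _) hne (by omega)
        have h6 := sh (ps b s + (ln (b s) + 5 - y)) (by omega) (by omega)
        rw [U_eq hb (by omega), show ps b s + (ln (b s) + 5 - y) + p =
          ps b (s + 1 + (k + 1)) + (ln (b (s + 1 + (k + 1))) + 5 - y) by omega,
          U_eq hb (by omega), ori_par (show (s + 1 + (k + 1)) % 2 = s % 2 by omega)] at h6
        exact hy3 (ori_inj h6).symm
      refine np s (k + 2) (by omega) (by omega) ?_
      intro x hx
      rcases Nat.eq_zero_or_pos x with h | h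
      · subst h
        rw [Nat.add_zero, Nat.add_zero, ← hB]
        congr 1; omega
      · obtain ⟨z, rfl⟩ : ∃ z, x = z + 1 := ⟨x - 1, by omega⟩
        have := i2 z (by omega)
        rw [show s + (z + 1) = s + 1 + z by omega, this]
        congr 1; omega
  · have hm2 : ∀ n, ¬ (i + p ≤ ps b n ∧ ps b n + 6 ≤ i + p + p) := by
      rintro n ⟨h1, h2⟩
      obtain ⟨n'', e, _⟩ := marker hb (y := ps b n - p) (n := n) (by
        intro x hx
        rw [← U_mk hb _ hx, sh _ (by omega) (by omega)]
        congr 1; omega)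
      exact hm ⟨n'', by omega, by omega⟩
    obtain ⟨n, h1, h2⟩ := ex_idx hb i
    have e1 : ps b (n + 1) = ps b n + ln (b n) := rfl
    have e2 : ps b (n + 2) = ps b (n + 1) + ln (b (n + 1)) := rfl
    by_cases hin : i + (p + p) ≤ ps b (n + 1) + 6
    · obtain ⟨y, hy, hne⟩ := spec3 (hb n) (i := i - ps b n) hp (by omega)
      have h6 := hsq y hy
      rw [show i + y = ps b n + (i - ps b n + y) by omega,
        show i + p + y = ps b n + (i - ps b n + p + y) by omega,
        U_eq hb (by omega), U_eq hb (by omega)] at h6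
      exact hne (ori_inj h6)
    · have h3 : ¬ (i ≤ ps b (n + 1) ∧ ps b (n + 1) + 6 ≤ i + p) := fun h => hm ⟨_, h⟩
      have h4 := hm2 (n + 1)
      have h5 := hm2 (n + 2)
      have h6 := ps_succ hb (n + 1)
      have h6' : ps b (n + 1) + 8 ≤ ps b (n + 2) := h6
      obtain ⟨y, hy, hne⟩ := spec4 (hb n) (hb (n + 1)) (he n) (x := i + p - ps b (n + 1)) (p := p)
        (by omega) (by omega) hp (by omega) (by omega)
      have h7 := hsq y hy
      rw [show i + y = ps b n + (ln (b n) + (i + p - ps b (n + 1)) - p + y) by omega,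
        show i + p + y = ps b (n + 1) + (i + p - ps b (n + 1) + y) by omega,
        U_eq hb (by omega), U_eq hb (by omega), ori_succ] at h7
      exact hne (ori_inj h7)

end word

theorem Wt_clamp (c d : ℕ) (h : 19 ≤ d) : Wt c d = Wt c 19 := by
  unfold Wt; rw [sel_eq, sel_eq, Nat.min_eq_right h, Nat.min_self]

theorem Sm_clamp (c d : ℕ) (h : 19 ≤ d) : Sm c d = Sm c 19 := by
  unfold Sm; rw [sel_eq, sel_eq, Nat.min_eq_right h, Nat.min_self]

theorem spec8 {c : ℕ} (hc : c < 28) : Wt c 19 = 3 ∧ ∀ d, d < 20 →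
    Wt c d ≠ 1 ∧ Sm c d ≤ Wt c d ∧ Sm c d ≤ Sm c (d + 1) := by
  have h := allN_spec chk8_ok c hc
  rw [Bool.and_eq_true, beq_t] at h
  refine ⟨h.1, ?_⟩
  intro d hd
  have h2 := allN_spec h.2 d hd
  rw [Bool.and_eq_true, Bool.and_eq_true, bne_t, ble_t, ble_t] at h2
  exact h2

theorem Wt_ne {c : ℕ} (hc : c < 28) (d : ℕ) : Wt c d ≠ 1 := by
  rcases Nat.lt_or_ge d 19 with h | h
  · exact ((spec8 hc).2 d (by omega)).1
  · rw [Wt_clamp c d h, (spec8 hc).1]; omega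

theorem Wt_le (c d : ℕ) : Wt c d ≤ 3 := by
  have : Wt c d < 4 := Nat.mod_lt _ (by omega)
  omega

theorem Sm_mono {c : ℕ} (hc : c < 28) : Monotone (Sm c) := by
  apply monotone_nat_of_le_succ
  intro d
  rcases Nat.lt_or_ge d 20 with h | h
  · exact ((spec8 hc).2 d h).2.2
  · rw [Sm_clamp c d (by omega), Sm_clamp c (d + 1) (by omega)]

theorem Sm_Wt {c : ℕ} (hc : c < 28) {x y : ℕ} (h : x ≤ y) : Sm c x ≤ Wt c y := by
  refine le_trans (Sm_mono hc h) ?_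
  rcases Nat.lt_or_ge y 19 with h | h
  · exact ((spec8 hc).2 y (by omega)).2.1
  · rw [Sm_clamp c y h, Wt_clamp c y h]
    exact ((spec8 hc).2 19 (by omega)).2.1

theorem sumE_eq (c0 d v n : ℕ) :
    sumE c0 d v n = ∑ c ∈ Finset.range n, (if edge c0 c = true then Cc d v c else 0) := by
  induction n with
  | zero => rfl
  | succ n ih =>
    rw [Finset.sum_range_succ, ← ih]
    show sumE c0 d v n + cond (edge c0 n) (Cc d v n) 0 = _
    cases edge c0 n <;> simp

theorem Cc_clamp {c : ℕ} (hc : c < 28) (d v : ℕ) (h : 45 ≤ d) : Cc d v c = Cc 45 v c := by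
  have := (spec1 hc).2.1
  unfold Cc
  rw [ble_t.mpr (show ln c ≤ d by omega), ble_t.mpr (show ln c ≤ 45 by omega)]
  show Wt c (d - ln c) = Wt c (45 - ln c)
  rw [Wt_clamp _ _ (by omega), Wt_clamp c (45 - ln c) (by omega)]

theorem spec7 {c0 : ℕ} (hc : c0 < 28) (d : ℕ) {v : ℕ} (hv : v ≤ 2) (h : Wt c0 d ≠ 0) :
    4 * Wt c0 d ≤ ∑ c ∈ Finset.range 28, (if edge c0 c = true then Cc d v c else 0) := by
  have key : ∀ d, d < 46 → Wt c0 d ≠ 0 →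
      4 * Wt c0 d ≤ ∑ c ∈ Finset.range 28, (if edge c0 c = true then Cc d v c else 0) := by
    intro d hd h
    have h1 := allN_spec (allN_spec (allN_spec chk7_ok c0 hc) d hd) v (by omega)
    have h2 := ble_t.mp (imp_spec h1 (bne_t.mpr h))
    rw [sumE_eq] at h2
    exact h2
  rcases Nat.lt_or_ge d 46 with hd | hd
  · exact key d hd h
  · have e : Wt c0 d = Wt c0 45 := by rw [Wt_clamp _ d (by omega), Wt_clamp _ 45 (by omega)]
    have h2 := key 45 (by omega) (by rw [← e]; exact h)
    rw [e]
    refine le_trans h2 (le_of_eq ?_)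
    apply Finset.sum_congr rfl
    intro c hc
    rw [Cc_clamp (Finset.mem_range.mp hc) d v (by omega)]

def pl : List ℕ → ℕ
  | [] => 0
  | c :: h => pl h + ln c

def okb (F : ℕ → Prop) (val : ℕ → ℕ) (n p c : ℕ) : Prop :=
  ∀ x, x < ln c → F (p + 6 + x) → ori n (ltr c (6 + x)) = val (p + 6 + x)

open Classical in
noncomputable def dist {F : ℕ → Prop} (hi : ∀ p, ∃ x, F (p + x)) (p : ℕ) : ℕ := Nat.find (hi p)

noncomputable def om {F : ℕ → Prop} (hi : ∀ p, ∃ x, F (p + x)) : List ℕ → ℕ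
  | [] => 0
  | c :: h => Wt c (dist hi (pl (c :: h) + 6))

def bad (l : List ℕ) : Prop := ∃ k, 2 ≤ k ∧ k % 2 = 0 ∧ 2 * k ≤ l.length + 1 ∧
  l.take (k - 1) = (l.drop k).take (k - 1)

def stp {F : ℕ → Prop} (hi : ∀ p, ∃ x, F (p + x)) (val : ℕ → ℕ) (h : List ℕ) (c : ℕ) : Prop :=
  edge (h.headD 0) c = true ∧ okb F val h.length (pl h) c ∧ om hi (c :: h) ≠ 0

open Classical in
noncomputable def XX {F : ℕ → Prop} (hi : ∀ p, ∃ x, F (p + x)) (val : ℕ → ℕ)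
    (S : Finset (List ℕ)) : Finset (List ℕ) :=
  ((S ×ˢ Finset.range 28).filter (fun q => stp hi val q.1 q.2)).image (fun q => q.2 :: q.1)

open Classical in
noncomputable def SS {F : ℕ → Prop} (hi : ∀ p, ∃ x, F (p + x)) (val : ℕ → ℕ) :
    ℕ → Finset (List ℕ)
  | 0 => {[0]}
  | n + 1 => (XX hi val (SS hi val n)).filter (fun l => ¬ bad l)

section count
variable {F : ℕ → Prop} (hi : ∀ p, ∃ x, F (p + x)) (val : ℕ → ℕ)

theorem dist_spec (p : ℕ) : F (p + dist hi p) := by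
  classical
  unfold dist; exact Nat.find_spec (hi p)

theorem dist_min {p x : ℕ} (h : F (p + x)) : dist hi p ≤ x := by
  classical
  unfold dist; exact Nat.find_min' (hi p) h

theorem term_ok (hgap : ∀ a b, F a → F b → a < b → a + 19 ≤ b) {n P c v : ℕ} (hc : c < 28)
    (hv : v = ori n (val (P + 6 + dist hi (P + 6))))
    (h : Cc (dist hi (P + 6)) v c ≠ 0) :
    okb F val n P c ∧ Cc (dist hi (P + 6)) v c ≤ Wt c (dist hi (P + ln c + 6)) := by
  set d := dist hi (P + 6) with hd
  have hF : F (P + 6 + d) := dist_spec hi _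
  have hF' := dist_spec hi (P + ln c + 6)
  set e := dist hi (P + ln c + 6) with he
  have oo : ∀ x, ori n (ori n x) = x := by
    intro x; unfold ori; split
    · rfl
    · exact tau_tau x
  unfold Cc at h ⊢
  cases h1 : Nat.ble (ln c) d
  · rw [h1] at h
    have h1' := ble_f.mp h1
    cases h2 : Nat.ble (ln c) (Nat.add d 19)
    · rw [h2] at h; exact absurd rfl h
    · rw [h2] at h
      have h2' : ln c ≤ d + 19 := ble_t.mp h2
      cases h3 : Nat.beq (ltr c (Nat.add 6 d)) v
      · rw [h3] at h; exact absurd rfl h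
      · have h3' : ltr c (6 + d) = v := beq_t.mp h3
        constructor
        · intro x hx hFx
          have hdx : d ≤ x := dist_min hi hFx
          rcases Nat.eq_or_lt_of_le hdx with hh | hh
          · rw [← hh, h3', hv, oo]
          · have := hgap _ _ hF hFx (by omega)
            omega
        · show Sm c (d + 19 - ln c) ≤ Wt c e
          apply Sm_Wt hc
          have := hgap _ _ hF hF' (by omega)
          omega
  · have h1' := ble_t.mp h1
    constructor
    · intro x hx hFx
      have hdx : d ≤ x := dist_min hi hFx
      omega
    · show Wt c (d - ln c) ≤ Wt c e
      have e1 : e = d - ln c := by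
        apply le_antisymm
        · apply dist_min
          rw [show P + ln c + 6 + (d - ln c) = P + 6 + d by omega]; exact hF
        · have : d ≤ ln c + e := by
            apply dist_min
            rw [show P + 6 + (ln c + e) = P + ln c + 6 + e by omega]; exact hF'
          omega
      rw [e1]

open Classical in
theorem local_sum (hgap : ∀ a b, F a → F b → a < b → a + 19 ≤ b) (hval : ∀ y, val y ≤ 2)
    {c0 : ℕ} (hc : c0 < 28) (h : List ℕ) (ho : om hi (c0 :: h) ≠ 0) :
    4 * om hi (c0 :: h) ≤
      ∑ c ∈ Finset.range 28, (if stp hi val (c0 :: h) c then om hi (c :: c0 :: h) else 0) := by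
  have h7 := spec7 hc (dist hi (pl (c0 :: h) + 6))
    (v := ori (c0 :: h).length (val (pl (c0 :: h) + 6 + dist hi (pl (c0 :: h) + 6))))
    (ori_le _ (hval _)) ho
  refine le_trans h7 (Finset.sum_le_sum ?_)
  intro c hc'
  rw [Finset.mem_range] at hc'
  split
  · rename_i hed
    by_cases hz : Cc (dist hi (pl (c0 :: h) + 6)) (ori (c0 :: h).length
        (val (pl (c0 :: h) + 6 + dist hi (pl (c0 :: h) + 6)))) c = 0
    · rw [hz]; exact Nat.zero_le _
    · obtain ⟨t1, t2⟩ := term_ok hi val hgap hc' rfl hz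
      have t2' : _ ≤ om hi (c :: c0 :: h) := t2
      rw [if_pos ⟨hed, t1, by omega⟩]
      exact t2'
  · exact Nat.zero_le _

theorem mem_XX {S : Finset (List ℕ)} {l : List ℕ} (h : l ∈ XX hi val S) :
    ∃ t c, l = c :: t ∧ t ∈ S ∧ c < 28 ∧ stp hi val t c := by
  classical
  unfold XX at h
  rw [Finset.mem_image] at h
  obtain ⟨⟨t, c⟩, h1, rfl⟩ := h
  rw [Finset.mem_filter, Finset.mem_product, Finset.mem_range] at h1
  exact ⟨t, c, rfl, h1.1.1, h1.1.2, h1.2⟩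

theorem mem_SS {n : ℕ} {l : List ℕ} (h : l ∈ SS hi val (n + 1)) :
    ∃ t c, l = c :: t ∧ t ∈ SS hi val n ∧ c < 28 ∧ stp hi val t c ∧ ¬ bad l := by
  classical
  unfold SS at h
  rw [Finset.mem_filter] at h
  obtain ⟨t, c, h1, h2, h3, h4⟩ := mem_XX hi val h.1
  exact ⟨t, c, h1, h2, h3, h4, h.2⟩

theorem drop_SS {m n : ℕ} : ∀ {l : List ℕ}, l ∈ SS hi val (n + m) → l.drop m ∈ SS hi val n := by
  induction m with
  | zero => intro l h; simpa using h
  | succ m ih =>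
    intro l h
    obtain ⟨t, c, rfl, h2, _⟩ := mem_SS hi val (n := n + m) h
    exact ih h2

theorem SS_len {n : ℕ} : ∀ {l : List ℕ}, l ∈ SS hi val n → l.length = n + 1 := by
  induction n with
  | zero => intro l h; unfold SS at h; rw [Finset.mem_singleton] at h; subst h; rfl
  | succ n ih =>
    intro l h
    obtain ⟨t, c, rfl, h2, _⟩ := mem_SS hi val h
    rw [List.length_cons, ih h2]

theorem SS_om (h0 : om hi [0] ≠ 0) {n : ℕ} {l : List ℕ} (h : l ∈ SS hi val n) :
    ∃ t c, l = c :: t ∧ c < 28 ∧ om hi l ≠ 0 := by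
  cases n with
  | zero =>
    unfold SS at h; rw [Finset.mem_singleton] at h; subst h
    exact ⟨[], 0, rfl, by omega, h0⟩
  | succ n =>
    obtain ⟨t, c, rfl, h2, h3, h4, _⟩ := mem_SS hi val h
    exact ⟨t, c, rfl, h3, h4.2.2⟩

theorem om_le (l : List ℕ) : om hi l ≤ 3 := by
  cases l with
  | nil => exact Nat.zero_le _
  | cons c h => exact Wt_le _ _

noncomputable def aa (n : ℕ) : ℕ := ∑ l ∈ SS hi val n, om hi l

theorem card_SS (h0 : om hi [0] ≠ 0) (n : ℕ) : 2 * (SS hi val n).card ≤ aa hi val n := by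
  unfold aa
  rw [mul_comm, ← smul_eq_mul]
  apply Finset.card_nsmul_le_sum
  intro l hl
  obtain ⟨t, c, rfl, h1, h2⟩ := SS_om hi val h0 hl
  have h3 : om hi (c :: t) ≠ 1 := Wt_ne h1 _
  omega

theorem sum_XX (hgap : ∀ a b, F a → F b → a < b → a + 19 ≤ b) (hval : ∀ y, val y ≤ 2)
    (h0 : om hi [0] ≠ 0) (n : ℕ) :
    4 * aa hi val n ≤ ∑ l ∈ XX hi val (SS hi val n), om hi l := by
  classical
  unfold XX aa
  rw [Finset.sum_image (by
    rintro ⟨a, b⟩ _ ⟨a', b'⟩ _ hh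
    simp only [List.cons.injEq] at hh
    rw [hh.1, hh.2]), Finset.sum_filter, Finset.sum_product, Finset.mul_sum]
  apply Finset.sum_le_sum
  intro l hl
  obtain ⟨t, c, rfl, h1, h2⟩ := SS_om hi val h0 hl
  exact local_sum hi val hgap hval h1 t h2

theorem card_bad (n : ℕ) [DecidablePred bad] : ((XX hi val (SS hi val n)).filter bad).card ≤
    ∑ j ∈ Finset.range (n / 2 + 1), (SS hi val (n - 2 * j)).card := by
  classical
  let B : ℕ → Finset (List ℕ) := fun j => (XX hi val (SS hi val n)).filter
    (fun l => 4 * j + 3 ≤ l.length ∧ l.take (2 * j + 1) = (l.drop (2 * j + 2)).take (2 * j + 1))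
  have h1 : (XX hi val (SS hi val n)).filter bad ⊆ (Finset.range (n / 2 + 1)).biUnion B := by
    intro l hl
    rw [Finset.mem_filter] at hl
    obtain ⟨hl, k, k1, k2, k3, k4⟩ := hl
    rw [Finset.mem_biUnion]
    obtain ⟨t, c, e, ht, _⟩ := mem_XX hi val hl
    have hlen : l.length = n + 2 := by rw [e, List.length_cons, SS_len hi val ht]
    refine ⟨k / 2 - 1, ?_, ?_⟩
    · rw [Finset.mem_range]; omega
    · rw [Finset.mem_filter]
      refine ⟨hl, by omega, ?_⟩
      rw [show 2 * (k / 2 - 1) + 1 = k - 1 by omega, show 2 * (k / 2 - 1) + 2 = k by omega]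
      exact k4
  refine le_trans (Finset.card_le_card h1) (le_trans Finset.card_biUnion_le ?_)
  apply Finset.sum_le_sum
  intro j hj
  rw [Finset.mem_range] at hj
  apply Finset.card_le_card_of_injOn (fun l => l.drop (2 * j + 1))
  · intro l hl
    have hl' : l ∈ B j := hl
    rw [Finset.mem_filter] at hl'
    obtain ⟨t, c, e, ht, _⟩ := mem_XX hi val hl'.1
    subst e
    show t.drop (2 * j) ∈ SS hi val (n - 2 * j)
    apply drop_SS
    rw [show n - 2 * j + 2 * j = n by omega]; exact ht
  · intro l hl l' hl' e
    have e' : l.drop (2 * j + 1) = l'.drop (2 * j + 1) := e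
    have m1 : l ∈ B j := hl
    have m2 : l' ∈ B j := hl'
    rw [Finset.mem_filter] at m1 m2
    have t1 := m1.2.2
    have t2 := m2.2.2
    have d1 : l.drop (2 * j + 2) = l'.drop (2 * j + 2) := by
      have := congrArg (List.drop 1) e'
      rw [List.drop_drop, List.drop_drop] at this
      exact this
    rw [← List.take_append_drop (2 * j + 1) l, ← List.take_append_drop (2 * j + 1) l', e', t1, t2, d1]

theorem geo (a : ℕ → ℕ) (n : ℕ) (h : ∀ m, m < n → 2 * a m ≤ a (m + 1)) :
    3 * ∑ j ∈ Finset.range (n / 2 + 1), a (n - 2 * j) ≤ 4 * a n := by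
  induction n using Nat.strong_induction_on with
  | _ n ih =>
    match n, ih, h with
    | 0, _, _ => simp; omega
    | 1, _, _ => simp; omega
    | m + 2, ih, h =>
      have h1 := ih m (by omega) (fun x hx => h x (by omega))
      have h2 := h m (by omega)
      have h3 := h (m + 1) (by omega)
      rw [show (m + 2) / 2 + 1 = (m / 2 + 1) + 1 by omega, Finset.sum_range_succ']
      have e : ∑ j ∈ Finset.range (m / 2 + 1), a (m + 2 - 2 * (j + 1)) =
          ∑ j ∈ Finset.range (m / 2 + 1), a (m - 2 * j) := by
        apply Finset.sum_congr rfl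
        intro j _
        congr 1; omega
      rw [e]
      have h3' : 2 * a (m + 1) ≤ a (m + 2) := h3
      simp only [Nat.mul_zero, Nat.sub_zero]
      omega

theorem growth (hgap : ∀ a b, F a → F b → a < b → a + 19 ≤ b) (hval : ∀ y, val y ≤ 2)
    (h0 : om hi [0] ≠ 0) (n : ℕ) : 2 * aa hi val n ≤ aa hi val (n + 1) := by
  classical
  induction n using Nat.strong_induction_on with
  | _ n ih =>
    have g := geo (aa hi val) n ih
    have h1 := sum_XX hi val hgap hval h0 n
    have h2 := card_bad hi val n
    have h3 : ∑ l ∈ XX hi val (SS hi val n), om hi l =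
        ∑ l ∈ (XX hi val (SS hi val n)).filter bad, om hi l + aa hi val (n + 1) := by
      rw [← Finset.sum_filter_add_sum_filter_not _ bad]; rfl
    have h4 : ∑ l ∈ (XX hi val (SS hi val n)).filter bad, om hi l ≤
        ((XX hi val (SS hi val n)).filter bad).card * 3 := by
      rw [← smul_eq_mul]
      exact Finset.sum_le_card_nsmul _ _ _ (fun l _ => om_le hi l)
    have h5 : 2 * ∑ j ∈ Finset.range (n / 2 + 1), (SS hi val (n - 2 * j)).card ≤
        ∑ j ∈ Finset.range (n / 2 + 1), aa hi val (n - 2 * j) := by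
      rw [Finset.mul_sum]
      exact Finset.sum_le_sum (fun j _ => card_SS hi val h0 _)
    omega

theorem SS_ne (hgap : ∀ a b, F a → F b → a < b → a + 19 ≤ b) (hval : ∀ y, val y ≤ 2)
    (h0 : om hi [0] ≠ 0) (n : ℕ) : (SS hi val n).Nonempty := by
  have h : 0 < aa hi val n := by
    induction n with
    | zero =>
      have : aa hi val 0 = om hi [0] := by
        unfold aa SS; rw [Finset.sum_singleton]
      omega
    | succ n ih =>
      have := growth hi val hgap hval h0 n
      omega
  by_contra hne
  rw [Finset.not_nonempty_iff_eq_empty] at hne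
  unfold aa at h
  rw [hne] at h
  simp at h

def Ext (n : ℕ) (h : List ℕ) : Prop := ∀ N, n ≤ N → ∃ l ∈ SS hi val N, l.drop (N - n) = h

theorem ext_step {n : ℕ} {h : List ℕ} (hE : Ext hi val n h) : ∃ c, Ext hi val (n + 1) (c :: h) := by
  by_contra hcon
  push Not at hcon
  unfold Ext at hcon
  push Not at hcon
  choose Nf h1 h2 using hcon
  obtain ⟨N, hN⟩ : ∃ N, N = (Finset.range 28).sup Nf + n + 1 := ⟨_, rfl⟩
  obtain ⟨l, hl, hd⟩ := hE N (by omega)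
  have hl' : l.drop (N - (n + 1)) ∈ SS hi val (n + 1) := by
    apply drop_SS
    rw [show n + 1 + (N - (n + 1)) = N by omega]; exact hl
  obtain ⟨t, c, e, ht, hc, _⟩ := mem_SS hi val hl'
  have et : t = h := by
    rw [← hd, show N - n = (N - (n + 1)) + 1 by omega, ← List.drop_drop, e]; rfl
  have hle : Nf c ≤ (Finset.range 28).sup Nf := Finset.le_sup (Finset.mem_range.mpr hc)
  have hc1 := h1 c
  refine h2 c (l.drop (N - Nf c)) ?_ ?_
  · apply drop_SS
    rw [show Nf c + (N - Nf c) = N by omega]; exact hl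
  · rw [List.drop_drop, show N - Nf c + (Nf c - (n + 1)) = N - (n + 1) by omega, e, et]

theorem ex_seq (hgap : ∀ a b, F a → F b → a < b → a + 19 ≤ b) (hval : ∀ y, val y ≤ 2)
    (h0 : om hi [0] ≠ 0) : ∃ b : ℕ → ℕ, b 0 = 0 ∧
      ∀ n, ((List.range (n + 1)).map b).reverse ∈ SS hi val n := by
  have hE0 : Ext hi val 0 [0] := by
    intro N _
    obtain ⟨l, hl⟩ := SS_ne hi val hgap hval h0 N
    refine ⟨l, hl, ?_⟩
    have : l.drop N ∈ SS hi val 0 := by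
      apply drop_SS; rw [Nat.zero_add]; exact hl
    unfold SS at this
    rw [Finset.mem_singleton] at this
    exact this
  choose! g hg using fun n h => @ext_step F hi val n h
  let Ls : ℕ → List ℕ := fun n => Nat.rec [0] (fun n h => g n h :: h) n
  have hLs : ∀ n, Ext hi val n (Ls n) := by
    intro n
    induction n with
    | zero => exact hE0
    | succ n ih => exact hg n (Ls n) ih
  let b : ℕ → ℕ := fun n => (Ls n).headD 0
  have hbL : ∀ n, Ls n = ((List.range (n + 1)).map b).reverse := by
    intro n
    induction n with
    | zero => rfl
    | succ n ih =>
      rw [List.range_succ, List.map_append, List.reverse_append, ← ih]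
      rfl
  refine ⟨b, rfl, ?_⟩
  intro n
  rw [← hbL]
  obtain ⟨l, hl, e⟩ := hLs n n (le_refl n)
  rw [Nat.sub_self, List.drop_zero] at e
  rw [← e]; exact hl

theorem pl_map (b : ℕ → ℕ) (n : ℕ) : pl ((List.range n).map b).reverse = ps b n := by
  induction n with
  | zero => rfl
  | succ n ih =>
    rw [List.range_succ, List.map_append, List.reverse_append]
    show pl ((List.range n).map b).reverse + ln (b n) = _
    rw [ih]; rfl

theorem exists_word (hi : ∀ p, ∃ x, F (p + x)) (hgap : ∀ a b, F a → F b → a < b → a + 19 ≤ b) (hval : ∀ y, val y ≤ 2)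
    (hfar : ∀ y, F y → 60 ≤ y) : ∃ u : ℕ → ℕ, (∀ y, u y ≤ 2) ∧ (∀ y, F y → u y = val y) ∧
      ∀ i p, 1 ≤ p → ¬ ∀ x, x < p → u (i + x) = u (i + p + x) := by
  have h0 : om hi [0] ≠ 0 := by
    have l26 := (spec1 (show 0 < 28 by omega)).2.1
    have hp : pl [0] = ln 0 := Nat.zero_add _
    have hd : 19 ≤ dist hi (pl [0] + 6) := by
      have := hfar _ (dist_spec hi (pl [0] + 6))
      omega
    show Wt 0 (dist hi (pl [0] + 6)) ≠ 0
    rw [Wt_clamp _ _ hd, (spec8 (by omega)).1]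
    omega
  obtain ⟨b, hb0, hb⟩ := ex_seq hi val hgap hval h0
  have hrev : ∀ n, ((List.range (n + 1)).map b).reverse = b n :: ((List.range n).map b).reverse := by
    intro n
    rw [List.range_succ, List.map_append, List.reverse_append]; rfl
  have hst : ∀ n, b (n + 1) < 28 ∧ edge (b n) (b (n + 1)) = true ∧
      okb F val (n + 1) (ps b (n + 1)) (b (n + 1)) ∧
      ¬ bad ((List.range (n + 2)).map b).reverse := by
    intro n
    obtain ⟨t, c, e, _, h3, h4, h5⟩ := mem_SS hi val (hb (n + 1))
    rw [hrev] at e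
    injection e with e1 e2
    subst e1 e2
    refine ⟨h3, ?_, ?_, h5⟩
    · have := h4.1
      rw [hrev] at this
      exact this
    · have := h4.2.1
      rw [pl_map, List.length_reverse, List.length_map, List.length_range] at this
      exact this
  have hb28 : ∀ n, b n < 28 := by
    intro n
    cases n with
    | zero => omega
    | succ n => exact (hst n).1
  refine ⟨U b, U_le hb28, ?_, ?_⟩
  · intro y hy
    have hy60 := hfar y hy
    obtain ⟨n, h1, h2⟩ := ex_idx hb28 (y - 6)
    have e1 : ps b (n + 1) = ps b n + ln (b n) := rfl
    cases n with
    | zero =>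
      have := (spec1 (hb28 0)).2.1
      have e0 : ps b 0 = 0 := rfl
      omega
    | succ n =>
      have hx : y - 6 - ps b (n + 1) < ln (b (n + 1)) := by omega
      have h3 := (hst n).2.2.1 (y - 6 - ps b (n + 1)) hx
      have e2 : ps b (n + 1) + 6 + (y - 6 - ps b (n + 1)) = y := by omega
      rw [e2] at h3
      rw [← h3 hy, ← U_eq hb28 (by omega)]
      congr 1; omega
  · intro i p hp hsq
    refine sq_free hb28 (fun n => (hst n).2.1) ?_ i p hp hsq
    intro s k hk hk2 hx
    have hget : ∀ n x, x < n → (((List.range n).map b).reverse)[x]? = some (b (n - 1 - x)) := by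
      intro n x hx
      rw [List.getElem?_reverse (by simpa using hx)]
      simp only [List.length_map, List.length_range]
      rw [List.getElem?_map, List.getElem?_range (by omega)]
      rfl
    have hnb := (hst (s + 2 * k - 3)).2.2.2
    rw [show s + 2 * k - 3 + 2 = s + 2 * k - 1 by omega] at hnb
    apply hnb
    refine ⟨k, hk, hk2, by simp; omega, ?_⟩
    apply List.ext_getElem?
    intro x
    rw [List.getElem?_take, List.getElem?_take]
    split
    · rw [List.getElem?_drop, hget _ _ (by omega), hget _ _ (by omega)]
      have := hx (k - 2 - x) (by omega)
      rw [show s + 2 * k - 1 - 1 - x = s + k + (k - 2 - x) by omega, ← this]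
      congr 2; omega
    · rfl

end count

end TT

theorem d_three_letters_le_19 :
    ∀ v : ℕ → Fin 3, ∀ q : ℕ → ℕ, 1 ≤ q 1 →
      (∀ i : ℕ, 1 ≤ i → q i + 19 ≤ q (i + 1)) →
      ∃ u : ℕ → Fin 3, SqFreeSeq u ∧ ∀ i : ℕ, 1 ≤ i → u (q i) = v i := by
  intro v q hq1 hq
  classical
  have hlt : ∀ i j, 1 ≤ i → i < j → q i + 19 ≤ q j := by
    intro i j hi hij
    induction j with
    | zero => omega
    | succ j ih =>
      rcases Nat.lt_succ_iff_lt_or_eq.mp hij with h | h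
      · have h1 := ih h
        have h2 := hq j (by omega)
        omega
      · subst h; exact hq i hi
  have hinj : ∀ i j, 1 ≤ i → 1 ≤ j → q i = q j → i = j := by
    intro i j hi hj e
    rcases Nat.lt_trichotomy i j with h | h | h
    · have := hlt i j hi h; omega
    · exact h
    · have := hlt j i hj h; omega
  have hgrow : ∀ i, i ≤ q (i + 1) := by
    intro i
    induction i with
    | zero => omega
    | succ i ih =>
      have := hq (i + 1) (by omega)
      omega
  let F : ℕ → Prop := fun y => ∃ i, 1 ≤ i ∧ y = q i + 60
  have hF : ∀ p, ∃ x, F (p + x) := by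
    intro p
    have := hgrow p
    exact ⟨q (p + 1) + 60 - p, p + 1, by omega, by omega⟩
  let val : ℕ → ℕ := fun y => if h : F y then (v h.choose).val else 0
  have hval : ∀ i, 1 ≤ i → val (q i + 60) = (v i).val := by
    intro i hi
    have h : F (q i + 60) := ⟨i, hi, rfl⟩
    have hs := h.choose_spec
    have e : h.choose = i := hinj _ _ hs.1 hi (by omega)
    show (if h : F (q i + 60) then (v h.choose).val else 0) = _
    rw [dif_pos h, e]
  obtain ⟨u, hu1, hu2, hu3⟩ := TT.exists_word (F := F) val hF (by
      rintro a b ⟨i, hi, rfl⟩ ⟨j, hj, rfl⟩ hab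
      have : i < j := by
        by_contra hn
        rcases Nat.eq_or_lt_of_le (Nat.le_of_not_lt hn) with h | h
        · subst h; omega
        · have := hlt j i hj h; omega
      have := hlt i j hi this
      omega) (by
      intro y
      show (if h : F y then (v h.choose).val else 0) ≤ 2
      split
      · have := (v (Exists.choose ‹F y›)).isLt
        omega
      · omega) (by
      rintro y ⟨i, _, rfl⟩
      omega)
  refine ⟨fun y => ⟨u (y + 60), by have := hu1 (y + 60); omega⟩, ?_, ?_⟩
  · intro i n _ hn
    by_contra hcon
    push Not at hcon
    refine hu3 (i + 60) n hn ?_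
    intro x hx
    have h := hcon x hx
    rw [Fin.mk.injEq] at h
    rw [show i + 60 + x = i + x + 60 by omega, show i + 60 + n + x = i + n + x + 60 by omega]
    exact h
  · intro i hi
    apply Fin.ext
    show u (q i + 60) = (v i).val
    rw [hu2 _ ⟨i, hi, rfl⟩, hval i hi]
end

section
/- Let Σ = {0,1,2} and let W = {⋄^9} ∪ {⋄^i a : 18 ≤ i ≤ 26, a ∈ Σ}, where ⋄^i denotes i consecutive wildcard symbols. For every infinite partial word μ obtained as a concatenation of infinitely many elements of W, the set S(μ) of finite square-free words over Σ compatible with μ is infinite. -/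
/-- The set `W = {⋄⁹} ∪ {⋄ⁱ a : 18 ≤ i ≤ 26, a ∈ Σ}` over the ternary alphabet. -/
def Wternary : Set (List (Option (Fin 3))) :=
  {List.replicate 9 none} ∪
    {w | ∃ (i : ℕ) (a : Fin 3), 18 ≤ i ∧ i ≤ 26 ∧ w = List.replicate i none ++ [some a]}

/-- the factor of `W` of length `l` starting at `a` -/
def wfac {α : Type*} (W : ℕ → α) (a l : ℕ) : List α := (List.range l).map (fun j => W (a + j))

theorem wfac_eq_iff {α : Type*} (W : ℕ → α) (a b l : ℕ) :
    wfac W a l = wfac W b l ↔ ∀ j < l, W (a + j) = W (b + j) := by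
  simp [wfac]

theorem wfac_sub {α : Type*} (W : ℕ → α) (a n s l : ℕ) (h : s + l ≤ n) :
    ((wfac W a n).drop s).take l = wfac W (a + s) l := by
  apply List.ext_getElem
  · simp [wfac]; omega
  · intro i h1 h2
    simp [wfac, Nat.add_assoc]

theorem core_sq {α β : Type*} (W : ℕ → α) (p : ℕ → ℕ) (t : ℕ → β) (n : ℕ)
    (hp0 : p 0 = 0) (hp : ∀ i, p i + 11 ≤ p (i + 1))
    (C1 : ∀ i s d, 1 ≤ d → p i ≤ s → s + 2 * d ≤ p (i + 1) + 11 → wfac W s d ≠ wfac W (s + d) d)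
    (C2 : ∀ i j s, p i ≤ s → s < p (i + 1) → wfac W s 11 = wfac W (p j) 11 →
      s = p i ∧ i % 2 = j % 2 ∧ t (i / 2) = t (j / 2))
    (C3 : ∀ i s, p i < s → s + 5 ≤ p (i + 1) + 11 → wfac W s 5 ≠ wfac W (p i) 5)
    (C4 : ∀ i s, p i ≤ s → s + 7 < p (i + 1) + 11 → wfac W s 7 ≠ wfac W (p (i + 1) + 4) 7)
    (ht : ∀ m d, 1 ≤ d → m + 2 * d ≤ n → ¬ ∀ j < d, t (m + j) = t (m + d + j)) :
    ∀ s d, 1 ≤ d → s + 2 * d ≤ 22 * n - 11 → wfac W s d ≠ wfac W (s + d) d := by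
  intro s d hd hN hsq
  have hmono : ∀ i k, p i + 11 * k ≤ p (i + k) := by
    intro i k
    induction k with
    | zero => simp
    | succ k ih => have := hp (i + k); rw [← Nat.add_assoc]; omega
  have hlt : ∀ i j, i < j → p i + 11 ≤ p j := by
    intro i j h
    obtain ⟨k, rfl⟩ := Nat.exists_eq_add_of_lt h
    have := hmono i (k + 1)
    rw [← Nat.add_assoc] at this
    omega
  have hinv : ∀ i j, p i < p j → i < j := by
    intro i j h
    by_contra hc
    rcases Nat.eq_or_lt_of_le (Nat.le_of_not_lt hc) with h1 | h1
    · subst h1; omega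
    · have := hlt _ _ h1; omega
  have hidx : ∀ i, 11 * i ≤ p i := by
    intro i; have := hmono 0 i; simp [hp0] at this; exact this
  have hloc : ∀ x, ∃ i, p i ≤ x ∧ x < p (i + 1) := by
    intro x
    have hex : ∃ i, x < p (i + 1) := ⟨x, by have := hidx (x + 1); omega⟩
    classical
    refine ⟨Nat.find hex, ?_, Nat.find_spec hex⟩
    rcases Nat.eq_zero_or_pos (Nat.find hex) with h0 | h0
    · rw [h0, hp0]; omega
    · have := Nat.find_min hex (m := Nat.find hex - 1) (by omega)
      rw [Nat.sub_add_cancel h0] at this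
      omega
  have hgen : ∀ x j, wfac W x 11 = wfac W (p j) 11 →
      ∃ i, x = p i ∧ i % 2 = j % 2 ∧ t (i / 2) = t (j / 2) := by
    intro x j h
    obtain ⟨i, h1, h2⟩ := hloc x
    exact ⟨i, C2 i j x h1 h2 h⟩
  have hsh : ∀ x l, s ≤ x → x + l ≤ s + d → wfac W x l = wfac W (x + d) l := by
    intro x l h1 h2
    rw [wfac_eq_iff] at hsq ⊢
    intro j hj
    have := hsq (x - s + j) (by omega)
    have e1 : s + (x - s + j) = x + j := by omega
    have e2 : s + d + (x - s + j) = x + d + j := by omega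
    rwa [e1, e2] at this
  -- tokens in the second half can be shifted back
  have hback : ∀ k, s + d ≤ p k → p k + 11 ≤ s + 2 * d →
      ∃ i, p i + d = p k ∧ s ≤ p i := by
    intro k h1 h2
    have h3 := hsh (p k - d) 11 (by omega) (by omega)
    rw [Nat.sub_add_cancel (by omega)] at h3
    obtain ⟨i, hi, -⟩ := hgen _ _ h3
    exact ⟨i, by omega, by omega⟩
  obtain ⟨i, hi1, hi2⟩ := hloc s
  have hin : p (i + 1) + 11 < s + 2 * d := by
    by_contra hc
    exact C1 i s d hd hi1 (by omega) hsq
  obtain ⟨a, ha1, ha2, ha3, ha4⟩ : ∃ a, s ≤ p a ∧ (∀ k, s ≤ p k → a ≤ k) ∧ (a = i + 1 ∨ a = i) ∧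
      p a + 11 < s + 2 * d := by
    by_cases h : p i = s
    · refine ⟨i, by omega, ?_, Or.inr rfl, by have := hp i; omega⟩
      intro k hk
      by_contra hc
      have := hlt k i (by omega)
      omega
    · refine ⟨i + 1, by omega, ?_, Or.inl rfl, hin⟩
      intro k hk
      by_contra hc
      have := hinv i k (by omega)
      omega
  by_cases hA : p a + 11 ≤ s + d
  · obtain ⟨b, hb, hpar, htt⟩ := hgen (p a + d) a (hsh (p a) 11 ha1 hA).symm
    have hab : a < b := hinv a b (by omega)
    obtain ⟨e, he⟩ : ∃ e, b = a + 2 * e := ⟨(b - a) / 2, by omega⟩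
    have he1 : 1 ≤ e := by omega
    have hb1 : p (b - 1) < s + d := by
      by_contra hc
      have h1 := hlt (b - 1) b (by omega)
      obtain ⟨k, hk1, hk2⟩ := hback (b - 1) (by omega) (by omega)
      have := ha2 k hk2
      rcases Nat.eq_or_lt_of_le this with h | h
      · subst h; omega
      · have := hlt _ _ h; omega
    have hind : ∀ j, j + 2 ≤ 2 * e → p (a + j) + d = p (b + j) ∧ p (b + j) + 11 ≤ s + 2 * d ∧
        t ((a + j) / 2) = t ((b + j) / 2) := by
      intro j
      induction j with
      | zero => intro _; exact ⟨by simpa using hb, by simp; omega, by simpa using htt.symm⟩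
      | succ j ih =>
        intro hj
        obtain ⟨h1, h2, -⟩ := ih (by omega)
        have h3 : p (a + (j + 1)) + 11 ≤ p (b - 1) := hlt _ _ (by omega)
        have h4 : p (a + j) + 11 ≤ p (a + (j + 1)) := hlt _ _ (by omega)
        have h5 : p a ≤ p (a + j) := by have := hmono a j; omega
        obtain ⟨k, hk, -, hkt⟩ := hgen (p (a + (j + 1)) + d) (a + (j + 1))
          (hsh _ 11 (by omega) (by omega)).symm
        have hk1 : b + j < k := hinv _ _ (by omega)
        have hk2 : k = b + (j + 1) := by
          by_contra hc
          have h6 := hlt (b + (j + 1)) k (by omega)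
          have h7 := hlt (b + j) (b + (j + 1)) (by omega)
          obtain ⟨l, hl1, hl2⟩ := hback (b + (j + 1)) (by omega) (by omega)
          have h8 := hinv (a + j) l (by omega)
          have h9 := hinv l (a + (j + 1)) (by omega)
          omega
        subst hk2
        exact ⟨hk, by omega, hkt.symm⟩
    have hlast := (hind (2 * e - 2) (by omega)).2.1
    have hbd := hidx (b + (2 * e - 2))
    refine ht (a / 2) e he1 (by omega) ?_
    intro j hj
    rcases Nat.mod_two_eq_zero_or_one a with h | h
    · have := (hind (2 * j) (by omega)).2.2
      have e1 : (a + 2 * j) / 2 = a / 2 + j := by omega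
      have e2 : (b + 2 * j) / 2 = a / 2 + e + j := by omega
      rwa [e1, e2] at this
    · have := (hind (2 * j - 1) (by omega)).2.2
      have e1 : (a + (2 * j - 1)) / 2 = a / 2 + j := by omega
      have e2 : (b + (2 * j - 1)) / 2 = a / 2 + e + j := by omega
      rwa [e1, e2] at this
  · have hac : p a < s + d := by
      by_contra hc
      obtain ⟨k, hk1, hk2⟩ := hback a (by omega) (by omega)
      have := ha2 k hk2
      have := hinv k a (by omega)
      omega
    have hai : a = i + 1 := by
      rcases ha3 with h | h
      · exact h
      · subst h
        have h2 := hp a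
        omega
    subst hai
    by_cases h4 : s + d ≤ p (i + 1) + 4
    · have h5 := hsh (p (i + 1) + 4 - d) 7 (by omega) (by omega)
      rw [Nat.sub_add_cancel (by omega)] at h5
      exact C4 i _ (by omega) (by omega) h5
    · have h5 := hsh (p (i + 1)) 5 (by omega) (by omega)
      have h6 : s + 2 * d < p (i + 1 + 1) + 11 := by
        by_contra hc
        have h7 := hp (i + 1)
        obtain ⟨k, hk1, hk2⟩ := hback (i + 1 + 1) (by omega) (by omega)
        have h8 := ha2 k hk2
        have h9 : p (i + 1) ≤ p k := by
          rcases Nat.eq_or_lt_of_le h8 with h | h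
          · rw [h]
          · have := hlt _ _ h; omega
        omega
      exact C3 (i + 1) (p (i + 1) + d) (by omega) (by omega) h5.symm

/-- letters of a decimal numeral, without the leading digit -/
def dcd : ℕ → ℕ → List (Fin 3) → List (Fin 3)
  | 0, _, acc => acc
  | k + 1, n, acc => if n < 10 then acc else
    if n % 10 = 0 then dcd k (n / 10) (0 :: acc) else
    if n % 10 = 1 then dcd k (n / 10) (1 :: acc) else dcd k (n / 10) (2 :: acc)

/-- fillers between consecutive tokens, one list for each kind of transition -/
def fil0 : List ℕ :=
  [120, 1120, 112102120, 12012102120, 11210212021020, 120102101202120, 1120102101202120,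
   112010212012102120, 112102120210201202120, 11201021202102012102120,
   120102101201021202101202120, 1121021201210120210201202120, 1201210212021020102101202120]

def fil1 : List ℕ :=
  [1, 1102120, 11202120, 112021020, 11021201020, 110212021020, 112101202120, 112021012102120,
   1102120210121020, 11021202101201020, 110212010201202120, 1120210121020102120,
   112021020121021201020, 11021202101210212021020, 11202120102012101202120,
   112101202101210201202120, 110212012102012021012102120, 1120212012101202102012102120,
   1121012021201020121012021020, 11202101201020121012021201020]

def fil2 : List ℕ :=
  [11, 112101, 11021202101, 110212010201, 110212012101, 1102120210201, 11202102012101,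
   11210120210201, 112021012010201, 1102120102012101, 11021202101210201, 112021201021202101,
   11202120121012010201, 112021012010212012101, 110212012101202101210201,
   112021201020121012010201, 1102120210120102120210201, 110212021012102120102012101,
   1102120102012101202101210201, 11021202101202120102120210201]

def fil : ℕ → List (List (Fin 3))
  | 0 => fil0.map (fun n => dcd 30 n [])
  | 1 => fil1.map (fun n => dcd 30 n [])
  | _ => fil2.map (fun n => dcd 30 n [])

def tok0 : List (Fin 3) := [0, 1, 0, 2, 0, 1, 2, 0, 2, 1, 0]

def tok1 : List (Fin 3) := [1, 0, 2, 1, 0, 1, 2, 1, 0, 2, 0]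

/-- the six tokens -/
def tok (q : ℕ) (c : Fin 3) : List (Fin 3) :=
  (if q = 0 then tok0 else tok1).map (fun x => x + c)

/-- bit masks of the winning states -/
def msk (q a : ℕ) : ℕ :=
  if q = 0 then (if a = 0 then 523998 else if a = 1 then 520172 else 524144)
  else (if a = 0 then 524224 else if a = 1 then 524176 else 524258)

def win (q k : ℕ) (a : Fin 3) : Bool := (msk q a.val).testBit k

def kq : ℕ → ℕ
  | 0 => 0
  | _ => 1

def kc : ℕ → Fin 3
  | 0 => 0
  | 1 => 1
  | _ => 2

def toks : List (List (Fin 3)) :=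
  [tok 0 0, tok 0 1, tok 0 2, tok 1 0, tok 1 1, tok 1 2]

def fc (s l : ℕ) (w : List (Fin 3)) : List (Fin 3) := (w.drop s).take l

/-- local conditions on a segment -/
def good (w : List (Fin 3)) (N : ℕ) : Bool :=
  (List.range N).all (fun s => (List.range ((N - s) / 2)).all (fun d =>
    fc s (d + 1) w != fc (s + (d + 1)) (d + 1) w)) &&
  (List.range N).all (fun s =>
    (s == 0 || decide (N ≤ s + 11) || !(toks.contains (fc s 11 w))) &&
    (s == 0 || decide (N < s + 5) || fc s 5 w != fc 0 5 w) &&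
    (decide (N ≤ s + 7) || fc s 7 w != fc (N - 7) 7 w))

def goodAll : Bool :=
  (List.range 3).all (fun r => (fil r).all (fun f =>
    good (tok (kq r) 0 ++ (f ++ tok (1 - kq r) (kc r))) (f.length + 22)))

/-- the strategy never gets stuck -/
def strat : Bool :=
  (List.range 3).all (fun r => (List.range 19).all (fun k => ([0, 1, 2] : List (Fin 3)).all (fun a =>
    !(win (kq r) k a) || (List.range 38).all (fun g => decide (g < 19) ||
      ([0, 1, 2] : List (Fin 3)).all (fun b =>
      (fil r).any (fun f => decide (f.length + 11 ≤ k + g) && decide (k < f.length + 11) && decide (k + g < f.length + 30) &&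
        win (1 - kq r) (k + g - (f.length + 11)) (b - kc r) &&
        (f ++ tok (1 - kq r) (kc r))[k]? == some a))))))

theorem goodAll_true : goodAll = true := by decide +kernel

theorem strat_true : strat = true := by decide +kernel

theorem strat_step (r k g : ℕ) (a b : Fin 3) (hr : r < 3) (hk : k < 19) (hw : win (kq r) k a = true)
    (hg1 : 19 ≤ g) (hg2 : g ≤ 37) :
    ∃ f ∈ fil r, f.length + 11 ≤ k + g ∧ k < f.length + 11 ∧ k + g < f.length + 30 ∧
      win (1 - kq r) (k + g - (f.length + 11)) (b - kc r) = true ∧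
      (f ++ tok (1 - kq r) (kc r))[k]? = some a := by
  have h := strat_true
  unfold strat at h
  rw [List.all_eq_true] at h
  have h := h r (List.mem_range.2 hr)
  rw [List.all_eq_true] at h
  have h := h k (List.mem_range.2 hk)
  rw [List.all_eq_true] at h
  have h := h a (by fin_cases a <;> simp)
  rw [hw, Bool.not_true, Bool.false_or, List.all_eq_true] at h
  have h := h g (List.mem_range.2 (by omega))
  rw [decide_eq_false (by omega), Bool.false_or, List.all_eq_true] at h
  have h := h b (by fin_cases b <;> simp)
  rw [List.any_eq_true] at h
  obtain ⟨f, hf, h⟩ := h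
  simp only [Bool.and_eq_true, decide_eq_true_eq, beq_iff_eq] at h
  exact ⟨f, hf, h.1.1.1.1, h.1.1.1.2, h.1.1.2, h.1.2, h.2⟩

theorem good_of_mem (r : ℕ) (hr : r < 3) (f : List (Fin 3)) (hf : f ∈ fil r) :
    good (tok (kq r) 0 ++ (f ++ tok (1 - kq r) (kc r))) (f.length + 22) = true := by
  have h := goodAll_true
  unfold goodAll at h
  rw [List.all_eq_true] at h
  have h := h r (List.mem_range.2 hr)
  rw [List.all_eq_true] at h
  exact h f hf

theorem good_spec (w : List (Fin 3)) (N : ℕ) (h : good w N = true) :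
    (∀ s d, 1 ≤ d → s + 2 * d ≤ N → fc s d w ≠ fc (s + d) d w) ∧
    (∀ s, 0 < s → s + 11 < N → fc s 11 w ∉ toks) ∧
    (∀ s, 0 < s → s + 5 ≤ N → fc s 5 w ≠ fc 0 5 w) ∧
    (∀ s, s + 7 < N → fc s 7 w ≠ fc (N - 7) 7 w) := by
  unfold good at h
  rw [Bool.and_eq_true, List.all_eq_true, List.all_eq_true] at h
  obtain ⟨h1, h2⟩ := h
  refine ⟨?_, ?_, ?_, ?_⟩
  · intro s d hd hs
    have h := h1 s (List.mem_range.2 (by omega))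
    rw [List.all_eq_true] at h
    have h := h (d - 1) (List.mem_range.2 (by omega))
    rw [Nat.sub_add_cancel hd] at h
    simpa using h
  · intro s h0 hs
    have h := h2 s (List.mem_range.2 (by omega))
    rw [Bool.and_eq_true, Bool.and_eq_true] at h
    have h := h.1.1
    rw [decide_eq_false (by omega)] at h
    have : s ≠ 0 := by omega
    simpa [this] using h
  · intro s h0 hs
    have h := h2 s (List.mem_range.2 (by omega))
    rw [Bool.and_eq_true, Bool.and_eq_true] at h
    have h := h.1.2
    rw [decide_eq_false (by omega)] at h
    have : s ≠ 0 := by omega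
    simpa [this] using h
  · intro s hs
    have h := h2 s (List.mem_range.2 (by omega))
    rw [Bool.and_eq_true, Bool.and_eq_true] at h
    have h := h.2
    rw [decide_eq_false (by omega)] at h
    simpa using h

theorem tok_mem (q : ℕ) (hq : q < 2) (c : Fin 3) : tok q c ∈ toks := by
  have : ∀ q < 2, ∀ c : Fin 3, tok q c ∈ toks := by decide +kernel
  exact this q hq c

theorem tok_inj (q q' : ℕ) (hq : q < 2) (hq' : q' < 2) (c c' : Fin 3) (h : tok q c = tok q' c') :
    q = q' ∧ c = c' := by
  have : ∀ q < 2, ∀ q' < 2, ∀ c c' : Fin 3, tok q c = tok q' c' → q = q' ∧ c = c' := by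
    decide +kernel
  exact this q hq q' hq' c c' h

theorem tok_len (q : ℕ) (c : Fin 3) : (tok q c).length = 11 := by
  unfold tok; split <;> simp [tok0, tok1]

theorem tok_shift (q : ℕ) (c d : Fin 3) : (tok q c).map (fun x => x + d) = tok q (c + d) := by
  unfold tok; simp [Function.comp_def, add_assoc]

theorem map_add_inj (c : Fin 3) (l l' : List (Fin 3))
    (h : l.map (fun x => x + c) = l'.map (fun x => x + c)) : l = l' :=
  List.map_injective_iff.2 (add_left_injective c) h

/-- bookkeeping: a word from its blocks -/
theorem glue (L : ℕ → List (Fin 3)) (p : ℕ → ℕ)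
    (hp : ∀ i, p (i + 1) = p i + (L i).length) (hL : ∀ i, 1 ≤ (L i).length) :
    ∃ W : ℕ → Fin 3, ∀ i, wfac W (p i) (L i).length = L i := by
  classical
  have hidx : ∀ i, i ≤ p i := by
    intro i
    induction i with
    | zero => simp
    | succ i ih => have := hp i; have := hL i; omega
  have hm : Monotone p := monotone_nat_of_le_succ (fun i => by have := hp i; omega)
  have hex : ∀ x, ∃ i, x < p (i + 1) := fun x => ⟨x, by have := hidx (x + 1); omega⟩
  refine ⟨fun x => (L (Nat.find (hex x))).getD (x - p (Nat.find (hex x))) 0, fun i => ?_⟩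
  apply List.ext_getElem
  · simp [wfac]
  · intro j h1 h2
    have hfi : Nat.find (hex (p i + j)) = i := by
      rw [Nat.find_eq_iff]
      refine ⟨by have := hp i; omega, ?_⟩
      intro m hm'
      have := hm (show m + 1 ≤ i by omega)
      omega
    simp only [wfac, List.getElem_map, List.getElem_range, hfi, Nat.add_sub_cancel_left]
    simp [h2]

theorem forced_seq (ν : ℕ → Option (Fin 3)) (h12 : ν 12 ≠ none) (hlow : ∀ x < 12, ν x = none)
    (hsp : ∀ x y, ν x ≠ none → x < y → y ≤ x + 18 → ν y = none) :
    ∃ F : ℕ → ℕ, F 0 = 12 ∧ (∀ i, F i + 19 ≤ F (i + 1) ∧ F (i + 1) ≤ F i + 37) ∧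
      ∀ x, ν x ≠ none → ∃ i, x = F i := by
  classical
  have step : ∀ P, (∀ y, P < y → y ≤ P + 18 → ν y = none) → ∃ Q, P + 19 ≤ Q ∧ Q ≤ P + 37 ∧
      (∀ y, P < y → y < Q → ν y = none) ∧ (∀ y, Q < y → y ≤ Q + 18 → ν y = none) := by
    intro P hP
    by_cases hex : ∃ Q, P + 19 ≤ Q ∧ Q ≤ P + 37 ∧ ν Q ≠ none
    · obtain ⟨h1, h2, h3⟩ := Nat.find_spec hex
      refine ⟨Nat.find hex, h1, h2, ?_, fun y hy hy' => hsp _ _ h3 hy hy'⟩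
      intro y hy hy'
      by_cases h : y ≤ P + 18
      · exact hP y hy h
      · by_contra hc
        exact Nat.find_min hex hy' ⟨by omega, by omega, hc⟩
    · refine ⟨P + 19, le_rfl, by omega, fun y h h' => hP y h (by omega), ?_⟩
      intro y hy hy'
      by_contra hc
      exact hex ⟨y, by omega, by omega, hc⟩
  let S : ℕ → {P // ∀ y, P < y → y ≤ P + 18 → ν y = none} := fun i =>
    Nat.rec ⟨12, fun y h h' => hsp _ _ h12 h h'⟩
      (fun _ s => ⟨(step s.1 s.2).choose, (step s.1 s.2).choose_spec.2.2.2⟩) i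
  have hS : ∀ i, (S (i + 1)).1 = (step (S i).1 (S i).2).choose := fun i => rfl
  refine ⟨fun i => (S i).1, rfl, ?_, ?_⟩
  · intro i
    have := (step (S i).1 (S i).2).choose_spec
    rw [← hS] at this
    exact ⟨this.1, this.2.1⟩
  · have hgrow : ∀ i, i ≤ (S i).1 := by
      intro i
      induction i with
      | zero => simp
      | succ i ih =>
        have := (step (S i).1 (S i).2).choose_spec.1
        rw [← hS] at this
        omega
    have hall : ∀ i x, x ≤ (S i).1 → ν x ≠ none → ∃ i, x = (S i).1 := by
      intro i
      induction i with
      | zero =>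
        intro x hx hν
        refine ⟨0, ?_⟩
        by_contra hc
        have hx' : x ≤ 12 := hx
        have hc' : x ≠ 12 := hc
        exact hν (hlow x (by omega))
      | succ i ih =>
        intro x hx hν
        by_cases h : x ≤ (S i).1
        · exact ih x h hν
        · refine ⟨i + 1, ?_⟩
          by_contra hc
          have := (step (S i).1 (S i).2).choose_spec.2.2.1
          rw [← hS] at this
          exact hν (this x (by omega) (by omega))
    exact fun x => hall x x (hgrow x)

/-- kind of the transition following token `i` -/
def kind (t : ℕ → Fin 3) (i : ℕ) : ℕ :=
  if i % 2 = 0 then 0 else if t (i / 2 + 1) = t (i / 2) + 1 then 1 else 2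

theorem kind_lt (t : ℕ → Fin 3) (i : ℕ) : kind t i < 3 := by
  unfold kind; split_ifs <;> omega

theorem kq_kind (t : ℕ → Fin 3) (i : ℕ) : kq (kind t i) = i % 2 := by
  unfold kind; split_ifs <;> simp [kq] <;> omega

theorem fin3_aux : ∀ x y : Fin 3, y ≠ x → y ≠ x + 1 → 2 + x = y := by decide

theorem kc_kind (t : ℕ → Fin 3) (ht : ∀ i, t i ≠ t (i + 1)) (i : ℕ) :
    kc (kind t i) + t (i / 2) = t ((i + 1) / 2) := by
  unfold kind
  split_ifs with h1 h2
  · have : (i + 1) / 2 = i / 2 := by omega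
    rw [this]; simp [kc]
  · have : (i + 1) / 2 = i / 2 + 1 := by omega
    rw [this, h2, add_comm]; rfl
  · have : (i + 1) / 2 = i / 2 + 1 := by omega
    rw [this]
    exact fin3_aux _ _ (ht _).symm h2

theorem core (t : ℕ → Fin 3) (n : ℕ) (htn : ∀ i, t i ≠ t (i + 1))
    (ht : ∀ m d, 1 ≤ d → m + 2 * d ≤ n → ¬ ∀ j < d, t (m + j) = t (m + d + j))
    (ν : ℕ → Option (Fin 3)) (h12 : ν 12 = some (t 0)) (hlow : ∀ x < 12, ν x = none)
    (hsp : ∀ x y, ν x ≠ none → x < y → y ≤ x + 18 → ν y = none) :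
    ∃ W : ℕ → Fin 3, (∀ x a, ν x = some a → W x = a) ∧ (∀ x, W x ≠ W (x + 1)) ∧
      ∀ s d, 1 ≤ d → s + 2 * d ≤ 22 * n - 11 → wfac W s d ≠ wfac W (s + d) d := by
  classical
  obtain ⟨F, hF0, hF, hFall⟩ := forced_seq ν (by simp [h12]) hlow hsp
  set G : ℕ → Fin 3 := fun i => (ν (F i)).getD 0 with hG
  let Inv : ℕ → ℕ → Prop := fun i P => P + 11 ≤ F i ∧ F i < P + 30 ∧
    win (i % 2) (F i - (P + 11)) (G i - t (i / 2)) = true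
  have hsteq : ∀ i, 1 - kq (kind t i) = (i + 1) % 2 := by
    intro i; rw [kq_kind]; omega
  have step : ∀ i P, Inv i P → ∃ f ∈ fil (kind t i), Inv (i + 1) (P + (11 + f.length)) ∧
      F i < P + 22 + f.length ∧
      (f ++ tok ((i + 1) % 2) (kc (kind t i)))[F i - (P + 11)]? = some (G i - t (i / 2)) := by
    rintro i P ⟨h1, h2, h3⟩
    have hFi := hF i
    obtain ⟨f, hf, e1, e2, e3, e4, e5⟩ := strat_step (kind t i) (F i - (P + 11)) (F (i + 1) - F i)
      (G i - t (i / 2)) (G (i + 1) - t (i / 2)) (kind_lt t i) (by omega) (by rw [kq_kind]; exact h3)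
      (by omega) (by omega)
    rw [hsteq] at e4 e5
    refine ⟨f, hf, ⟨by omega, by omega, ?_⟩, by omega, e5⟩
    have a1 : F (i + 1) - (P + (11 + f.length) + 11) =
        F i - (P + 11) + (F (i + 1) - F i) - (f.length + 11) := by omega
    have a2 : G (i + 1) - t ((i + 1) / 2) = G (i + 1) - t (i / 2) - kc (kind t i) := by
      rw [← kc_kind t htn i, sub_sub, add_comm (t (i / 2))]
    rw [a1, a2]
    exact e4
  have hG0 : G 0 = t 0 := by simp [hG, hF0, h12]
  have inv0 : Inv 0 0 := by
    refine ⟨by omega, by omega, ?_⟩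
    rw [hF0, hG0]
    simp only [Nat.zero_div, Nat.zero_mod, sub_self]
    decide
  let S : (i : ℕ) → {P // Inv i P} := fun i =>
    Nat.rec ⟨0, inv0⟩ (fun i s => ⟨_, (step i s.1 s.2).choose_spec.2.1⟩) i
  let f : ℕ → List (Fin 3) := fun i => (step i (S i).1 (S i).2).choose
  let p : ℕ → ℕ := fun i => (S i).1
  have hpS : ∀ i, p (i + 1) = p i + (11 + (f i).length) := fun i => rfl
  have hp0 : p 0 = 0 := rfl
  have hfm : ∀ i, f i ∈ fil (kind t i) := fun i => (step i (S i).1 (S i).2).choose_spec.1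
  have hft : ∀ i, F i < p i + 22 + (f i).length ∧
      (f i ++ tok ((i + 1) % 2) (kc (kind t i)))[F i - (p i + 11)]? = some (G i - t (i / 2)) :=
    fun i => (step i (S i).1 (S i).2).choose_spec.2.2
  have hpF : ∀ i, p i + 11 ≤ F i := fun i => (S i).2.1
  clear_value f p
  have hp : ∀ i, p i + 11 ≤ p (i + 1) := by intro i; have := hpS i; omega
  obtain ⟨W, hW⟩ := glue
    (fun i => tok (i % 2) (t (i / 2)) ++ (f i).map (fun x => x + t (i / 2))) p
    (by intro i; simp [tok_len, hpS]) (by intro i; simp [tok_len]; omega)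
  -- tokens and segments
  have htk : ∀ i, wfac W (p i) 11 = tok (i % 2) (t (i / 2)) := by
    intro i
    have h := congrArg (fun l => (l.drop 0).take 11) (hW i)
    beta_reduce at h
    rw [wfac_sub _ _ _ _ _ (by simp [tok_len])] at h
    rw [Nat.add_zero] at h
    rw [h]
    simp [tok_len]
  set w : ℕ → List (Fin 3) := fun i =>
    tok (kq (kind t i)) 0 ++ (f i ++ tok (1 - kq (kind t i)) (kc (kind t i))) with hw
  have hwl : ∀ i, (w i).length = (f i).length + 22 := by
    intro i; simp [hw, tok_len]; omega
  have hseg : ∀ i, wfac W (p i) ((f i).length + 22) = (w i).map (fun x => x + t (i / 2)) := by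
    intro i
    have e1 : (w i).map (fun x => x + t (i / 2)) =
        (tok (i % 2) (t (i / 2)) ++ (f i).map (fun x => x + t (i / 2))) ++
          tok ((i + 1) % 2) (t ((i + 1) / 2)) := by
      simp only [hw, List.map_append, tok_shift, kc_kind t htn, zero_add, kq_kind,
        List.append_assoc]
      congr 3
      omega
    rw [e1, ← hW i, ← htk (i + 1)]
    simp only [wfac, List.length_append, List.length_map, tok_len, hpS i]
    have : (f i).length + 22 = (11 + (f i).length) + 11 := by omega
    rw [this, List.range_add, List.map_append, List.map_map]
    simp [Function.comp_def, Nat.add_assoc]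
  have hfc : ∀ i s l, s + l ≤ (f i).length + 22 →
      wfac W (p i + s) l = (fc s l (w i)).map (fun x => x + t (i / 2)) := by
    intro i s l h
    rw [← wfac_sub W (p i) _ s l h, hseg, fc, List.map_take, List.map_drop]
  have hgs := fun i => good_spec (w i) _ (good_of_mem (kind t i) (kind_lt t i) (f i) (hfm i))
  have C1 : ∀ i s d, 1 ≤ d → p i ≤ s → s + 2 * d ≤ p (i + 1) + 11 →
      wfac W s d ≠ wfac W (s + d) d := by
    intro i s d hd h1 h2 h
    obtain ⟨x, rfl⟩ := Nat.exists_eq_add_of_le h1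
    have h3 := hpS i
    rw [Nat.add_assoc, hfc i _ _ (by omega), hfc i _ _ (by omega)] at h
    exact (hgs i).1 x d hd (by omega) (map_add_inj _ _ _ h)
  refine ⟨W, ?_, ?_, core_sq W p t n hp0 hp C1 ?_ ?_ ?_ ht⟩
  · intro x a hxa
    obtain ⟨i, rfl⟩ := hFall x (by simp [hxa])
    obtain ⟨h1, h2⟩ := hft i
    have h3 := hpF i
    have hGa : G i = a := by simp [hG, hxa]
    have e1 : (w i)[F i - p i]? = some (G i - t (i / 2)) := by
      rw [← h2, hw]
      simp only []
      rw [List.getElem?_append_right (by simp [tok_len]; omega), tok_len, hsteq]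
      congr 1
    have e2 := congrArg (fun l => l[F i - p i]?) (hseg i)
    simp only [List.getElem?_map, e1] at e2
    rw [wfac, List.getElem?_map, List.getElem?_range (by omega)] at e2
    simp only [Option.map_some, Option.some.injEq] at e2
    rw [Nat.add_sub_cancel' (by omega)] at e2
    rw [e2, hGa]
    abel
  · intro x hx
    have hidx : ∀ i, i ≤ p i := by
      intro i
      induction i with
      | zero => simp
      | succ i ih => have := hp i; omega
    have hex : ∃ i, x < p (i + 1) := ⟨x, by have := hidx (x + 1); omega⟩
    have h1 : p (Nat.find hex) ≤ x := by
      rcases Nat.eq_zero_or_pos (Nat.find hex) with h0 | h0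
      · rw [h0, hp0]; omega
      · have := Nat.find_min hex (m := Nat.find hex - 1) (by omega)
        rw [Nat.sub_add_cancel h0] at this
        omega
    have h2 := Nat.find_spec hex
    refine C1 _ x 1 le_rfl h1 (by omega) ?_
    simpa [wfac] using hx
  · intro i j s h1 h2 h
    obtain ⟨x, rfl⟩ := Nat.exists_eq_add_of_le h1
    have h3 := hpS i
    rcases Nat.eq_zero_or_pos x with rfl | hx
    · rw [Nat.add_zero, htk, htk] at h
      exact ⟨rfl, tok_inj _ _ (by omega) (by omega) _ _ h⟩
    · exfalso
      rw [hfc i _ _ (by omega), htk] at h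
      have e : tok (j % 2) (t (j / 2)) =
          (tok (j % 2) (t (j / 2) - t (i / 2))).map (fun x => x + t (i / 2)) := by
        rw [tok_shift, sub_add_cancel]
      rw [e] at h
      have h := map_add_inj _ _ _ h
      refine (hgs i).2.1 x hx (by omega) ?_
      rw [h]
      exact tok_mem _ (by omega) _
  · intro i s h1 h2 h
    obtain ⟨x, rfl⟩ := Nat.exists_eq_add_of_le h1.le
    have h3 := hpS i
    rw [hfc i _ _ (by omega)] at h
    have e := hfc i 0 5 (by omega)
    rw [Nat.add_zero] at e
    rw [e] at h
    exact (hgs i).2.2.1 x (by omega) (by omega) (map_add_inj _ _ _ h)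
  · intro i s h1 h2 h
    obtain ⟨x, rfl⟩ := Nat.exists_eq_add_of_le h1
    have h3 := hpS i
    have e : p (i + 1) + 4 = p i + ((f i).length + 22 - 7) := by omega
    rw [e, hfc i _ _ (by omega), hfc i _ _ (by omega)] at h
    exact (hgs i).2.2.2 x (by omega) (map_add_inj _ _ _ h)

/-- the version for a partial word with well separated letters -/
theorem core_mu (t : ℕ → Fin 3) (n : ℕ) (htn : ∀ i, t i ≠ t (i + 1))
    (ht : ∀ m d, 1 ≤ d → m + 2 * d ≤ n → ¬ ∀ j < d, t (m + j) = t (m + d + j))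
    (μ : ℕ → Option (Fin 3)) (hlow : ∀ x < 18, μ x = none)
    (hsp : ∀ x y, μ x ≠ none → x < y → y ≤ x + 18 → μ y = none) :
    ∃ W : ℕ → Fin 3, (∀ x a, μ x = some a → W x = a) ∧ (∀ x, W x ≠ W (x + 1)) ∧
      ∀ s d, 1 ≤ d → s + 2 * d ≤ 22 * n - 24 → ¬ ∀ j < d, W (s + j) = W (s + d + j) := by
  obtain ⟨W, h1, h2, h3⟩ := core t n htn ht
    (fun x => if x < 12 then none else if x = 12 then some (t 0) else μ (x - 13)) (by simp)
    (by intro x hx; simp [hx]) (by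
      intro x y hx hxy hy
      by_cases c1 : x < 12
      · simp [c1] at hx
      · by_cases c2 : x = 12
        · have a1 : ¬ y < 12 := by omega
          have a2 : ¬ y = 12 := by omega
          simp only [a1, a2, if_false]
          exact hlow _ (by omega)
        · have a1 : ¬ y < 12 := by omega
          have a2 : ¬ y = 12 := by omega
          simp only [a1, a2, c1, c2, if_false] at hx ⊢
          exact hsp _ _ hx (by omega) (by omega))
  refine ⟨fun x => W (13 + x), ?_, fun x => h2 _, ?_⟩
  · intro x a hx
    refine h1 _ _ ?_
    have a1 : ¬ 13 + x < 12 := by omega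
    have a2 : ¬ 13 + x = 12 := by omega
    simp only [a1, a2, if_false, Nat.add_sub_cancel_left]
    exact hx
  · intro s d hd hs h
    refine h3 (13 + s) d hd (by omega) ?_
    rw [wfac_eq_iff]
    intro j hj
    have := h j hj
    simpa only [Nat.add_assoc] using this

theorem exists_t (n : ℕ) : ∃ t : ℕ → Fin 3, (∀ i, t i ≠ t (i + 1)) ∧
    ∀ m d, 1 ≤ d → m + 2 * d ≤ n + 2 → ¬ ∀ j < d, t (m + j) = t (m + d + j) := by
  induction n with
  | zero =>
    refine ⟨fun i => if i % 2 = 0 then 0 else 1, ?_, ?_⟩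
    · intro i
      rcases Nat.mod_two_eq_zero_or_one i with h | h
      · have : (i + 1) % 2 = 1 := by omega
        simp [h, this]
      · have : (i + 1) % 2 = 0 := by omega
        simp [h, this]
    · intro m d hd hm h
      have e1 : m = 0 := by omega
      have e2 : d = 1 := by omega
      subst e1 e2
      have := h 0 (by omega)
      simp at this
  | succ n ih =>
    obtain ⟨t, h1, h2⟩ := ih
    obtain ⟨W, -, g1, g2⟩ := core_mu t (n + 2) h1 h2 (fun _ => none) (by simp) (by simp)
    exact ⟨W, g1, fun m d hd hm => g2 m d hd (by omega)⟩

theorem mu_struct (μ : ℕ → Option (Fin 3)) (h : InOmega Wternary μ) :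
    ∀ x, μ x ≠ none → 18 ≤ x ∧ ∀ y, y < x → x ≤ y + 18 → μ y = none := by
  classical
  obtain ⟨g, hg, hμ⟩ := h
  set P : ℕ → ℕ := fun k => ∑ j ∈ Finset.range k, (g j).length with hP
  have hPs : ∀ k, P (k + 1) = P k + (g k).length := fun k => Finset.sum_range_succ _ _
  have hlen : ∀ k, 1 ≤ (g k).length := by
    intro k
    rcases hg k with h | ⟨i, a, h1, h2, h⟩
    · rw [Set.mem_singleton_iff.1 h]; simp
    · rw [h]; simp
  have hidx : ∀ i, i ≤ P i := by
    intro i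
    induction i with
    | zero => simp
    | succ i ih => have := hPs i; have := hlen i; omega
  intro x hx
  have hex : ∃ i, x < P (i + 1) := ⟨x, by have := hidx (x + 1); omega⟩
  obtain ⟨k, hk1, hk2⟩ : ∃ k, P k ≤ x ∧ x < P (k + 1) := by
    refine ⟨Nat.find hex, ?_, Nat.find_spec hex⟩
    rcases Nat.eq_zero_or_pos (Nat.find hex) with h0 | h0
    · rw [h0]; simp [hP]
    · have := Nat.find_min hex (m := Nat.find hex - 1) (by omega)
      rw [Nat.sub_add_cancel h0] at this
      omega
  have h3 := hPs k
  have h4 := hμ k (x - P k) (by omega)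
  have e : P k + (x - P k) = x := by omega
  change (g k)[x - P k]? = some (μ (P k + (x - P k))) at h4
  rw [e] at h4
  rcases hg k with h | ⟨i, a, h1, h2, h⟩
  · rw [Set.mem_singleton_iff.1 h] at h4
    rw [List.getElem?_replicate] at h4
    split_ifs at h4
    simp at h4
    exact absurd h4.symm hx
  · have hl : (g k).length = i + 1 := by rw [h]; simp
    have hxi : x = P k + i := by
      by_contra hc
      rw [h, List.getElem?_append_left (by simp; omega), List.getElem?_replicate] at h4
      split_ifs at h4
      simp at h4
      exact hx h4.symm
    refine ⟨by omega, ?_⟩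
    intro y hy1 hy2
    have h5 := hμ k (y - P k) (by omega)
    have e : P k + (y - P k) = y := by omega
    change (g k)[y - P k]? = some (μ (P k + (y - P k))) at h5
    rw [e, h, List.getElem?_append_left (by simp; omega), List.getElem?_replicate] at h5
    split_ifs at h5
    simp at h5
    exact h5.symm

theorem ternary_W_omega_avoidable :
    ∀ μ : ℕ → Option (Fin 3), InOmega Wternary μ →
      {v : List (Fin 3) | SqFree v ∧ CompatInf v μ}.Infinite := by
  intro μ hμ
  have hs := mu_struct μ hμ
  have key : ∀ n : ℕ, ∃ v : List (Fin 3), v.length = n ∧ SqFree v ∧ CompatInf v μ := by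
    intro n
    obtain ⟨t, h1, h2⟩ := exists_t n
    obtain ⟨W, g0, g1, g2⟩ := core_mu t (n + 2) h1 h2 μ
      (by
        intro x hx
        by_contra hc
        have := (hs x hc).1
        omega)
      (by
        intro x y hx hxy hy
        by_contra hc
        exact hx ((hs y hc).2 x hxy hy))
    refine ⟨wfac W 0 n, by simp [wfac], ?_, ?_⟩
    · rintro v hv ⟨a, b, hab⟩
      have hl := congrArg List.length hab
      simp [wfac] at hl
      have hvl : 1 ≤ v.length := List.length_pos_iff.2 hv
      refine g2 a.length v.length hvl (by omega) ?_
      intro j hj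
      have q1 := congrArg (fun l => l[a.length + j]?) hab
      have q2 := congrArg (fun l => l[a.length + v.length + j]?) hab
      simp only [wfac, List.getElem?_map, List.append_assoc, Nat.add_assoc] at q1 q2
      rw [List.getElem?_range (by omega)] at q1 q2
      rw [List.getElem?_append_right (by omega)] at q1 q2
      rw [List.getElem?_append_left (by simp; omega)] at q1
      rw [List.getElem?_append_right (by omega), List.getElem?_append_left (by omega)] at q2
      have e1 : a.length + j - a.length = j := by omega
      have e2 : a.length + (v.length + j) - a.length - v.length = j := by omega
      rw [e1] at q1
      rw [e2, q1] at q2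
      simp only [Option.map_some, Option.some.injEq, Nat.zero_add] at q2
      rw [Nat.add_assoc]
      exact q2
    · intro i hi a ha
      have hi' : i < n := by simpa [wfac] using hi
      rw [wfac, List.getElem?_map, List.getElem?_range hi']
      simp [g0 i a ha]
  intro hfin
  obtain ⟨N, hN⟩ := (hfin.image List.length).bddAbove
  obtain ⟨v, hv1, hv2⟩ := key (N + 1)
  have := hN ⟨v, hv2, hv1⟩
  omega
end

section
/- The set of finite square-free words u = u_1 … u_{|u|} over the alphabet {0,1,2} such that for every integer j ≥ 0 with 6j + 1 ≤ |u| one has u_{6j+1} = j mod 3 (i.e., the finite square-free ternary words compatible with the infinite partial word (0⋄⋄⋄⋄⋄1⋄⋄⋄⋄⋄2⋄⋄⋄⋄⋄)^ω) is finite and has exactly 4281 elements. -/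
namespace SF

/-- agreement on the first `l` letters -/
def eqn (l : ℕ) : List (Fin 3) → List (Fin 3) → Bool :=
  Nat.rec (fun _ _ => true) (fun _ ih a b =>
    List.rec false (fun x as _ =>
      List.rec false (fun y bs _ =>
        Bool.rec false (ih as bs) (Nat.beq x.1 y.1)) b) a) l

/-- no prefix square with half-length at least `l + 1`, where `t` is `c :: x` with `l + 1`
letters dropped -/
def go (c : Fin 3) (x : List (Fin 3)) (t : List (Fin 3)) : ℕ → Bool :=
  List.rec (fun _ => true) (fun b t ih l =>
    Bool.rec (ih (Nat.succ l))
     (Bool.rec (ih (Nat.succ l)) false (eqn l x t)) (Nat.beq c.1 b.1)) t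

def okp (p : Option (Fin 3)) (c : Fin 3) : Bool :=
  Option.rec true (fun a => Nat.beq a.1 c.1) p

def test (p : Option (Fin 3)) (c : Fin 3) (w : List (Fin 3)) : Bool :=
  Bool.rec false (go c w w Nat.zero) (okp p c)

def cnt (ps : List (Option (Fin 3))) : List (Fin 3) → ℕ :=
  List.rec (fun _ => 5000) (fun p _ ih w =>
    Nat.succ (Nat.add (Bool.rec 0 (ih (⟨0, by decide⟩ :: w)) (test p ⟨0, by decide⟩ w))
      (Nat.add (Bool.rec 0 (ih (⟨1, by decide⟩ :: w)) (test p ⟨1, by decide⟩ w))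
        (Bool.rec 0 (ih (⟨2, by decide⟩ :: w)) (test p ⟨2, by decide⟩ w))))) ps

def blk : List (Option (Fin 3)) :=
  [some 0, none, none, none, none, none, some 1, none, none, none, none, none,
   some 2, none, none, none, none, none]

def pat : List (Option (Fin 3)) := blk ++ (blk ++ (blk ++ (blk ++ (blk ++ blk))))

set_option maxRecDepth 100000 in
theorem cnt_pat : cnt pat [] = 4281 := by decide +kernel

theorem eqn_iff (l : ℕ) : ∀ a b : List (Fin 3),
    eqn l a b = true ↔ ∃ s : List (Fin 3), s.length = l ∧ s <+: a ∧ s <+: b := by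
  induction l with
  | zero =>
    intro a b
    exact ⟨fun _ => ⟨[], rfl, List.nil_prefix, List.nil_prefix⟩, fun _ => rfl⟩
  | succ l ih =>
    intro a b
    rcases a with _ | ⟨x, as⟩
    · refine ⟨fun h => absurd (show false = true from h) (by decide), ?_⟩
      rintro ⟨s, hs, h1, _⟩
      have := h1.length_le
      simp at this
      simp [this] at hs
    rcases b with _ | ⟨y, bs⟩
    · refine ⟨fun h => absurd (show false = true from h) (by decide), ?_⟩
      rintro ⟨s, hs, _, h1⟩
      have := h1.length_le
      simp at this
      simp [this] at hs
    have e : eqn (l+1) (x :: as) (y :: bs)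
        = Bool.rec false (eqn l as bs) (Nat.beq x.1 y.1) := rfl
    rw [e]
    by_cases hxy : x = y
    · subst hxy
      have : Nat.beq x.1 x.1 = true := by simp
      rw [this]
      show eqn l as bs = true ↔ _
      rw [ih]
      constructor
      · rintro ⟨s, hs, h1, h2⟩
        exact ⟨x :: s, by simp [hs], by simpa using h1, by simpa using h2⟩
      · rintro ⟨s, hs, h1, h2⟩
        rcases s with _ | ⟨z, s⟩
        · simp at hs
        · rw [List.cons_prefix_cons] at h1 h2
          exact ⟨s, by simpa using hs, h1.2, h2.2⟩
    · have : Nat.beq x.1 y.1 = false := by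
        rw [Bool.eq_false_iff]
        intro h
        exact hxy (Fin.ext (Nat.eq_of_beq_eq_true h))
      rw [this]
      refine ⟨fun h => absurd (show false = true from h) (by decide), ?_⟩
      rintro ⟨s, hs, h1, h2⟩
      rcases s with _ | ⟨z, s⟩
      · simp at hs
      · rw [List.cons_prefix_cons] at h1 h2
        exact absurd (h1.1.symm.trans h2.1) hxy

theorem go_iff (c : Fin 3) (x t : List (Fin 3)) : ∀ l : ℕ, go c x t l = true ↔
    ∀ r t', t = r ++ c :: t' → ¬ eqn (l + r.length) x t' = true := by
  induction t with
  | nil =>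
    intro l
    refine ⟨fun _ r t' h => by simp at h, fun _ => rfl⟩
  | cons b t ih =>
    intro l
    have e : go c x (b :: t) l = Bool.rec (go c x t (l+1))
       (Bool.rec (go c x t (l+1)) false (eqn l x t)) (Nat.beq c.1 b.1) := rfl
    have key : go c x (b :: t) l = true ↔ go c x t (l+1) = true ∧ ¬ (c = b ∧ eqn l x t = true) := by
      rw [e]
      by_cases hcb : c = b
      · subst hcb
        have : Nat.beq c.1 c.1 = true := by simp
        rw [this]
        cases h : eqn l x t <;> simp
      · have : Nat.beq c.1 b.1 = false := by
          rw [Bool.eq_false_iff]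
          intro h
          exact hcb (Fin.ext (Nat.eq_of_beq_eq_true h))
        rw [this]
        simp [hcb]
    rw [key, ih]
    constructor
    · rintro ⟨h1, h2⟩ r t' h
      rcases r with _ | ⟨d, r⟩
      · simp at h
        obtain ⟨rfl, rfl⟩ := h
        intro h3
        exact h2 ⟨rfl, h3⟩
      · simp at h
        have := h1 r t' h.2
        rwa [show l + (d :: r).length = l + 1 + r.length by simp; omega]
    · intro h
      constructor
      · intro r t' ht
        have := h (b :: r) t' (by simp [ht])
        rwa [show l + (b :: r).length = l + 1 + r.length by simp; omega] at this
      · rintro ⟨rfl, h3⟩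
        exact h [] t rfl h3

theorem go_sq (c : Fin 3) (w : List (Fin 3)) : go c w w 0 = true ↔
    ∀ v : List (Fin 3), v ≠ [] → ¬ (v ++ v) <+: (c :: w) := by
  rw [go_iff]
  constructor
  · intro h v hv hp
    rcases v with _ | ⟨d, v⟩
    · exact hv rfl
    obtain ⟨z, hz⟩ := hp
    simp at hz
    obtain ⟨rfl, hz⟩ := hz
    refine h v (v ++ z) hz.symm ((eqn_iff _ _ _).2 ⟨v, by simp, ⟨_, hz⟩, ⟨z, rfl⟩⟩)
  · intro h r t' hw he
    obtain ⟨s, hs, h1, h2⟩ := (eqn_iff _ _ _).1 he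
    have hr : r <+: w := ⟨_, hw.symm⟩
    have : s = r := (List.prefix_of_prefix_length_le h1 hr (by omega)).eq_of_length (by omega)
    subst this
    obtain ⟨z, rfl⟩ := h2
    exact h (c :: s) (by simp) ⟨z, by simp [hw]⟩

theorem sqFree_cons (c : Fin 3) (w : List (Fin 3)) :
    SqFree (c :: w) ↔ SqFree w ∧ go c w w 0 = true := by
  rw [go_sq]
  unfold SqFree
  simp only [List.infix_cons_iff]
  grind

theorem sqFree_reverse (w : List (Fin 3)) : SqFree w.reverse ↔ SqFree w := by
  have key : ∀ w : List (Fin 3), SqFree w → SqFree w.reverse := by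
    intro w h v hv hi
    refine h v.reverse (by simpa using hv) ?_
    rw [← List.reverse_infix]
    simpa using hi
  exact ⟨fun h => by simpa using key _ h, key w⟩

theorem mod3 (j : ℕ) : j % 3 < 3 := Nat.mod_lt _ (Nat.succ_pos 2)

def Forced (u : List (Fin 3)) : Prop :=
  ∀ j : ℕ, 6 * j + 1 ≤ u.length → u[6 * j]? = some ⟨j % 3, mod3 j⟩

def Good (w : List (Fin 3)) : Prop := SqFree w ∧ Forced w.reverse

def P (n : ℕ) : Option (Fin 3) := if n % 6 = 0 then some ⟨n / 6 % 3, by omega⟩ else none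

theorem okp_iff (n : ℕ) (c : Fin 3) : okp (P n) c = true ↔
    ∀ j, n = 6 * j → c = ⟨j % 3, mod3 j⟩ := by
  unfold P
  split_ifs with h
  · show Nat.beq (n / 6 % 3) c.1 = true ↔ _
    rw [Nat.beq_eq]
    constructor
    · rintro h1 j rfl
      apply Fin.ext
      simp at h1 ⊢
      omega
    · intro h1
      have := h1 (n / 6) (by omega)
      rw [this]
  · refine ⟨fun _ j hj => by omega, fun _ => rfl⟩

theorem forced_cons (c : Fin 3) (w : List (Fin 3)) :
    Forced (c :: w).reverse ↔ Forced w.reverse ∧ okp (P w.length) c = true := by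
  rw [okp_iff]
  unfold Forced
  simp only [List.reverse_cons, List.length_append, List.length_reverse, List.length_singleton]
  constructor
  · intro h
    constructor
    · intro j hj
      have := h j (by omega)
      rwa [List.getElem?_append_left (by simp; omega)] at this
    · intro j hj
      have := h j (by omega)
      rw [List.getElem?_append_right (by simp; omega)] at this
      simpa [hj] using this
  · rintro ⟨h1, h2⟩ j hj
    by_cases hl : 6 * j < w.length
    · rw [List.getElem?_append_left (by simp; omega)]
      exact h1 j (by omega)
    · rw [List.getElem?_append_right (by simp; omega)]
      have := h2 j (by omega)
      have h0 : 6 * j - w.length = 0 := by omega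
      simp [h0, this]

theorem good_cons (c : Fin 3) (w : List (Fin 3)) :
    Good (c :: w) ↔ Good w ∧ test (P w.length) c w = true := by
  have : test (P w.length) c w = true ↔ okp (P w.length) c = true ∧ go c w w 0 = true := by
    have e : test (P w.length) c w = Bool.rec false (go c w w 0) (okp (P w.length) c) := rfl
    rw [e]
    cases okp (P w.length) c <;> simp
  rw [this]
  unfold Good
  rw [sqFree_cons, forced_cons]
  tauto

theorem good_suffix (w : List (Fin 3)) : ∀ z, Good (z ++ w) → Good w := by
  intro z
  induction z with
  | nil => exact id
  | cons c z ih => exact fun h => ih ((good_cons c _).1 h).1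

theorem suffix_cases (w v : List (Fin 3)) : w <:+ v ↔
    v = w ∨ (0 :: w) <:+ v ∨ (1 :: w) <:+ v ∨ (2 :: w) <:+ v := by
  constructor
  · rintro ⟨z, rfl⟩
    rcases List.eq_nil_or_concat z with rfl | ⟨z, c, rfl⟩
    · simp
    · right
      have : ∀ d, c = d → (d :: w) <:+ (z.concat c ++ w) := by
        rintro d rfl
        exact ⟨z, by simp⟩
      have hc : c = 0 ∨ c = 1 ∨ c = 2 := by clear this; revert c; decide
      rcases hc with h | h | h
      · exact Or.inl (by simpa using this _ h)
      · exact Or.inr (Or.inl (by simpa using this _ h))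
      · exact Or.inr (Or.inr (by simpa using this _ h))
  · rintro (rfl | h | h | h)
    · exact List.suffix_refl _
    all_goals exact (List.suffix_cons _ _).trans h

theorem suffix_inj (w v : List (Fin 3)) (c d : Fin 3) (h1 : (c :: w) <:+ v) (h2 : (d :: w) <:+ v) :
    c = d := by
  have := (List.suffix_of_suffix_length_le h1 h2 (by simp)).eq_of_length (by simp)
  simpa using this

theorem suffix_irr (w : List (Fin 3)) (c : Fin 3) : ¬ (c :: w) <:+ w := by
  intro h
  have := h.length_le
  simp at this

def Enum (w : List (Fin 3)) (n : ℕ) : Prop :=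
  ∃ L : List (List (Fin 3)), L.Nodup ∧ L.length = n ∧ ∀ v, v ∈ L ↔ Good v ∧ w <:+ v

theorem enum_main (ps : List (Option (Fin 3))) : ∀ w, Good w →
    ps = (List.range' w.length ps.length).map P → cnt ps w < 5000 → Enum w (cnt ps w) := by
  induction ps with
  | nil =>
    intro w _ _ h
    exact absurd (show 5000 < 5000 from h) (by decide)
  | cons p ps ih =>
    intro w hw hps hlt
    simp only [List.length_cons, List.range'_succ, List.map_cons, List.cons.injEq] at hps
    obtain ⟨hp, hps⟩ := hps
    have br : ∀ c : Fin 3,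
        (Bool.rec 0 (cnt ps (c :: w)) (test p c w) : ℕ) < 5000 →
        Enum (c :: w) (Bool.rec 0 (cnt ps (c :: w)) (test p c w)) := by
      intro c
      have hg := good_cons c w
      rw [← hp] at hg
      cases ht : test p c w with
      | false =>
        intro _
        refine ⟨[], List.nodup_nil, rfl, fun v => ?_⟩
        simp only [List.not_mem_nil, false_iff, not_and]
        rintro hv ⟨z, rfl⟩
        have := (hg.1 (good_suffix _ z hv)).2
        simp [ht] at this
      | true =>
        intro h
        exact ih (c :: w) (hg.2 ⟨hw, ht⟩) (by simpa using hps) h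
    have e : cnt (p :: ps) w = Nat.succ (
      (Bool.rec 0 (cnt ps (0 :: w)) (test p 0 w) : ℕ) +
      ((Bool.rec 0 (cnt ps (1 :: w)) (test p 1 w) : ℕ) +
        (Bool.rec 0 (cnt ps (2 :: w)) (test p 2 w) : ℕ))) := rfl
    rw [e] at hlt ⊢
    have b0 := br 0
    have b1 := br 1
    have b2 := br 2
    clear br e
    generalize (Bool.rec 0 (cnt ps (0 :: w)) (test p 0 w) : ℕ) = n0 at *
    generalize (Bool.rec 0 (cnt ps (1 :: w)) (test p 1 w) : ℕ) = n1 at *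
    generalize (Bool.rec 0 (cnt ps (2 :: w)) (test p 2 w) : ℕ) = n2 at *
    obtain ⟨L0, d0, l0, m0⟩ := b0 (by omega)
    obtain ⟨L1, d1, l1, m1⟩ := b1 (by omega)
    obtain ⟨L2, d2, l2, m2⟩ := b2 (by omega)
    refine ⟨w :: (L0 ++ (L1 ++ L2)), ?_, by simp [l0, l1, l2], ?_⟩
    · rw [List.nodup_cons, List.nodup_append, List.nodup_append]
      refine ⟨?_, d0, ⟨d1, d2, ?_⟩, ?_⟩
      · simp only [List.mem_append, m0, m1, m2]
        have := suffix_irr w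
        rintro (h | h | h)
        · exact this _ h.2
        · exact this _ h.2
        · exact this _ h.2
      · rintro a ha b hb rfl
        exact absurd (suffix_inj w a 1 2 ((m1 a).1 ha).2 ((m2 a).1 hb).2) (by decide)
      · rintro a ha b hb rfl
        rcases List.mem_append.1 hb with hb | hb
        · exact absurd (suffix_inj w a 0 1 ((m0 a).1 ha).2 ((m1 a).1 hb).2) (by decide)
        · exact absurd (suffix_inj w a 0 2 ((m0 a).1 ha).2 ((m2 a).1 hb).2) (by decide)
    · intro v
      rw [suffix_cases w v]
      simp only [List.mem_cons, List.mem_append, m0, m1, m2]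
      constructor
      · rintro (rfl | h | h | h)
        · exact ⟨hw, Or.inl rfl⟩
        · tauto
        · tauto
        · tauto
      · tauto

theorem good_nil : Good [] := by
  refine ⟨fun v hv h => ?_, fun j hj => by simp at hj⟩
  simp at h
  exact hv h

theorem pat_eq : pat = (List.range' 0 pat.length).map P := by decide +kernel

end SF

theorem count_squarefree_ternary_forced_6 :
    {u : List (Fin 3) | SqFree u ∧
        ∀ j : ℕ, 6 * j + 1 ≤ u.length → u[6 * j]? = some ⟨j % 3, by omega⟩}.Finite ∧
      {u : List (Fin 3) | SqFree u ∧
        ∀ j : ℕ, 6 * j + 1 ≤ u.length → u[6 * j]? = some ⟨j % 3, by omega⟩}.ncard = 4281 := by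
  have h := SF.enum_main SF.pat [] SF.good_nil SF.pat_eq (by rw [SF.cnt_pat]; norm_num)
  rw [SF.cnt_pat] at h
  obtain ⟨L, hd, hl, hm⟩ := h
  have hS : {u : List (Fin 3) | SqFree u ∧
        ∀ j : ℕ, 6 * j + 1 ≤ u.length → u[6 * j]? = some ⟨j % 3, by omega⟩}
      = ((L.map List.reverse).toFinset : Set (List (Fin 3))) := by
    ext u
    simp only [Set.mem_ofPred_eq, List.coe_toFinset, List.mem_map]
    constructor
    · rintro ⟨h1, h2⟩
      refine ⟨u.reverse, (hm _).2 ⟨⟨(SF.sqFree_reverse u).2 h1, ?_⟩, List.nil_suffix⟩, by simp⟩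
      rw [List.reverse_reverse]
      exact h2
    · rintro ⟨v, hv, rfl⟩
      have := ((hm v).1 hv).1
      exact ⟨(SF.sqFree_reverse v).2 this.1, this.2⟩
  rw [hS]
  refine ⟨Finset.finite_toSet _, ?_⟩
  rw [Set.ncard_coe_finset, List.toFinset_card_of_nodup (hd.map List.reverse_injective),
    List.length_map, hl]
end
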